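/- arXiv:2502.12357 — 5 statements merged into one kernel-verified Lean document; each statement's English description precedes it below -/
import Mathlib

section
/- Let D be a Prüfer domain that is a ℚ-algebra (contains the field of rational numbers) such that for every maximal ideal 𝔪 of D, the valuation ring D_𝔪 has divisible value group. Then D is universally Japanese. -/
set_option synthInstance.maxHeartbeats 400000
set_option maxHeartbeats 800000

universe u

/-- An integral domain `S` is N-1 if the integral closure of `S` in its fraction
field is a finitely generated `S`-module. -/
def IsN1 (S : Type u) [CommRing S] [IsDomain S] : Prop :=
  Module.Finite S (integralClosure S (FractionRing S))

/-- An integral domain `S` is N-2 (Japanese) if for every finite field extension `L`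
of its fraction field, the integral closure of `S` in `L` is a finitely generated
`S`-module. -/
def IsN2 (S : Type u) [CommRing S] [IsDomain S] : Prop :=
  ∀ (L : Type u) [Field L] [Algebra S L] [Algebra (FractionRing S) L]
    [IsScalarTower S (FractionRing S) L],
    FiniteDimensional (FractionRing S) L → Module.Finite S (integralClosure S L)

/-- A commutative ring `R` is universally Japanese if every finite type `R`-algebra
that is an integral domain is N-1. -/
def UniversallyJapanese (R : Type u) [CommRing R] : Prop :=
  ∀ (A : Type u) [CommRing A] [IsDomain A] [Algebra R A],
    Algebra.FiniteType R A → IsN1 A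

/-- A Prüfer domain is an integral domain whose localization at every prime ideal
is a valuation ring. -/
def IsPruferDomain (D : Type u) [CommRing D] [IsDomain D] : Prop :=
  ∀ (P : Ideal D) [P.IsPrime], ValuationRing (Localization.AtPrime P)

/-- An integral domain `V` (with fraction field `K`) has divisible value group if
for every `x ∈ K^×` and every `n ≥ 1` there is `y ∈ K^×` with `yⁿ·x⁻¹` a unit
of `V`. -/
def HasDivisibleValueGroup (V : Type u) [CommRing V] [IsDomain V] : Prop :=
  ∀ x : FractionRing V, x ≠ 0 → ∀ n : ℕ, 1 ≤ n →
    ∃ y : FractionRing V, ∃ u : Vˣ,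
      algebraMap V (FractionRing V) u = y ^ n * x⁻¹

/-- Any two elements of `R` are comparable for divisibility in the localization at `p`. -/
def Ideal.LocallyTotal {R : Type*} [CommRing R] (p : Ideal R) : Prop :=
  ∀ a b : R, ∃ s ∉ p, ∃ c, s * a = c * b ∨ s * b = c * a

/-- Every element of `R` has `k`-th roots up to units in the localization at `p`. -/
def Ideal.LocallyDivisible {R : Type*} [CommRing R] (p : Ideal R) : Prop :=
  ∀ (a : R) (k : ℕ), k ≠ 0 → ∃ y : R, ∃ s ∉ p, ∃ t ∉ p, s * y ^ k = t * a

theorem Ideal.LocallyTotal.exists_forall_dvd {R : Type*} [CommRing R] {p : Ideal R} [p.IsPrime]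
    (h : p.LocallyTotal) {T : Type*} (S : Finset T) (hS : S.Nonempty) (w : T → R) :
    ∃ t₀ ∈ S, ∃ s ∉ p, ∀ t ∈ S, ∃ c, s * w t = c * w t₀ := by
  classical
  induction hS using Finset.Nonempty.cons_induction with
  | singleton a =>
    exact ⟨a, by simp, 1, p.ne_top_iff_one.mp ‹p.IsPrime›.ne_top,
      by simpa using ⟨1, (one_mul _).symm⟩⟩
  | cons a S ha hS ih =>
    obtain ⟨t₀, ht₀, s, hs, hd⟩ := ih
    obtain ⟨s', hs', c, hc | hc⟩ := h (w t₀) (w a)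
    · refine ⟨a, by simp, s * s', ‹p.IsPrime›.mul_notMem hs hs', fun t ht => ?_⟩
      rcases Finset.mem_cons.mp ht with rfl | ht
      · exact ⟨_, rfl⟩
      · obtain ⟨d, hd⟩ := hd t ht
        exact ⟨d * c, by linear_combination s' * hd + d * hc⟩
    · refine ⟨t₀, by simp [ht₀], s * s', ‹p.IsPrime›.mul_notMem hs hs', fun t ht => ?_⟩
      rcases Finset.mem_cons.mp ht with rfl | ht
      · exact ⟨s * c, by linear_combination s * hc⟩
      · obtain ⟨d, hd⟩ := hd t ht
        exact ⟨d * s', by linear_combination s' * hd⟩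

section LeadingPositions

variable {D : Type*} [CommRing D] {T : Type*} [LinearOrder T]

/-- The positions of leading entries of vectors in `W` reduced modulo `m`. -/
def leadingPositions (m : Ideal D) (W : Submodule D (T → D)) : Set T :=
  {s | ∃ w ∈ W, w s ∉ m ∧ ∀ t, s < t → w t ∈ m}

variable [Fintype T] {m : Ideal D} {W : Submodule D (T → D)}

theorem eq_zero_of_forall_leadingPositions [IsDomain D] [m.IsPrime] (hm : m.LocallyTotal)
    (hW : ∀ a : D, a ≠ 0 → ∀ w, a • w ∈ W → w ∈ W) {w : T → D} (hw : w ∈ W)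
    (h0 : ∀ s ∈ leadingPositions m W, w s = 0) : w = 0 := by
  classical
  by_contra hne
  obtain ⟨t₁, ht₁⟩ := Function.ne_iff.mp hne
  obtain ⟨t₀, -, s, hs, hd⟩ := hm.exists_forall_dvd Finset.univ ⟨t₁, by simp⟩ w
  have hs0 : s ≠ 0 := fun h => hs (h ▸ m.zero_mem)
  choose c hc using fun t => hd t (Finset.mem_univ t)
  have ha : w t₀ ≠ 0 := by
    intro h
    have := hc t₁
    rw [h, mul_zero] at this
    exact (mul_ne_zero hs0 ht₁) this
  have hct₀ : c t₀ = s := (mul_right_cancel₀ ha (hc t₀)).symm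
  have hcW : c ∈ W := hW _ ha _ <| by
    convert W.smul_mem s hw using 1
    ext t
    simp [hc t, mul_comm]
  let S := Finset.univ.filter fun t => c t ∉ m
  have hS : S.Nonempty := ⟨t₀, by simp [S, hct₀, hs]⟩
  have hmem := S.max'_mem hS
  have hlead : S.max' hS ∈ leadingPositions m W := by
    refine ⟨c, hcW, by simpa [S] using hmem, fun t ht => ?_⟩
    by_contra hcon
    exact absurd (S.le_max' t (by simp [S, hcon])) (not_le.mpr ht)
  have h1 := hc (S.max' hS)
  rw [h0 _ hlead, mul_zero] at h1
  have h2 : c (S.max' hS) = 0 := (mul_eq_zero.mp h1.symm).resolve_right ha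
  exact (Finset.mem_filter.mp hmem).2 (h2 ▸ m.zero_mem)

theorem det_notMem_of_leading [m.IsPrime] {U : Type*} [LinearOrder U] [Fintype U]
    (A : Matrix U U D) (h1 : ∀ s, A s s ∉ m) (h2 : ∀ s t, s < t → A s t ∈ m) :
    A.det ∉ m := by
  rw [← Ideal.Quotient.eq_zero_iff_mem, RingHom.map_det, Matrix.det_of_isLowerTriangular]
  · rw [Finset.prod_eq_zero_iff]
    rintro ⟨s, -, hs⟩
    exact h1 s (Ideal.Quotient.eq_zero_iff_mem.mp (by simpa using hs))
  · intro s t hst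
    exact Ideal.Quotient.eq_zero_iff_mem.mpr (h2 _ _ hst)

theorem exists_smul_mem_span_of_leadingPositions [IsDomain D] [m.IsPrime] (hm : m.LocallyTotal)
    (hW : ∀ a : D, a ≠ 0 → ∀ w, a • w ∈ W → w ∈ W) (v : T → T → D)
    (hv : ∀ s ∈ leadingPositions m W, v s ∈ W ∧ v s s ∉ m ∧ ∀ t, s < t → v s t ∈ m) :
    ∃ δ ∉ m, ∀ w ∈ W, δ • w ∈ Submodule.span D (v '' leadingPositions m W) := by
  classical
  let U := leadingPositions m W
  let A : Matrix U U D := fun s t => v s t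
  refine ⟨A.det, det_notMem_of_leading A (fun s => (hv s s.2).2.1)
    (fun s t hst => (hv s s.2).2.2 t hst), fun w hw => ?_⟩
  let c : U → D := Matrix.vecMul (fun s : U => w s) A.adjugate
  have hsum : ∑ s : U, c s • v s ∈ Submodule.span D (v '' U) :=
    Submodule.sum_mem _ fun s _ => Submodule.smul_mem _ _
      (Submodule.subset_span ⟨s, s.2, rfl⟩)
  have hsumW : ∑ s : U, c s • v s ∈ W :=
    Submodule.sum_mem _ fun s _ => Submodule.smul_mem _ _ (hv s s.2).1
  have : A.det • w - ∑ s : U, c s • v s = 0 := by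
    refine eq_zero_of_forall_leadingPositions hm hW
      (W.sub_mem (W.smul_mem _ hw) hsumW) fun t ht => ?_
    have h1 : Matrix.vecMul c A = A.det • fun s : U => w s := by
      rw [Matrix.vecMul_vecMul, Matrix.adjugate_mul, Matrix.vecMul_smul, Matrix.vecMul_one]
    have h2 := congrFun h1 ⟨t, ht⟩
    simp only [Matrix.vecMul, dotProduct, Pi.smul_apply] at h2
    simp only [Pi.sub_apply, Pi.smul_apply, Finset.sum_apply, smul_eq_mul, sub_eq_zero]
    exact h2.symm
  rw [sub_eq_zero.mp this]
  exact hsum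

theorem card_leadingPositions [IsDomain D] [m.IsPrime] (hm : m.LocallyTotal)
    (hW : ∀ a : D, a ≠ 0 → ∀ w, a • w ∈ W → w ∈ W) :
    (Nat.card (leadingPositions m W) : Cardinal) = Module.rank D W := by
  classical
  let U := leadingPositions m W
  choose! v hv using fun s (hs : s ∈ U) => hs
  change (Nat.card U : Cardinal) = _
  apply le_antisymm
  · let A : Matrix U U D := fun s t => v s t
    have hdet : A.det ≠ 0 := fun h => det_notMem_of_leading A (fun s => (hv s s.2).2.1)
      (fun s t hst => (hv s s.2).2.2 t hst) (h ▸ m.zero_mem)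
    have hli : LinearIndependent D A := Matrix.linearIndependent_rows_of_det_ne_zero hdet
    have hli' : LinearIndependent D fun s : U => (⟨v s, (hv s s.2).1⟩ : W) := by
      refine LinearIndependent.of_comp ((LinearMap.funLeft D D (Subtype.val : U → T)).comp
        W.subtype) ?_
      exact hli
    have := hli'.cardinal_lift_le_rank
    rw [← Nat.cast_card] at this
    simpa using this
  · let f : W →ₗ[D] (U → D) := (LinearMap.funLeft D D (Subtype.val : U → T)).comp W.subtype
    have hf : Function.Injective f := by
      rw [injective_iff_map_eq_zero]
      rintro ⟨w, hw⟩ h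
      ext1
      exact eq_zero_of_forall_leadingPositions hm hW hw fun s hs => congrFun h ⟨s, hs⟩
    have := LinearMap.lift_rank_le_of_injective f hf
    rw [rank_fun'] at this
    rw [← Nat.card_eq_fintype_card] at this
    simpa using this

end LeadingPositions

/-- Upward closed sets with the same finite counting function, in a graded well-quasi-order, are
generated in bounded degree. -/
theorem WellQuasiOrdered.exists_uniform_bound {X I : Type*} {r : X → X → Prop}
    (hr : WellQuasiOrdered r) (deg : X → ℕ) (hfin : ∀ e, {x | deg x = e}.Finite) (U : I → Set X)
    (hU : ∀ i x y, r x y → x ∈ U i → y ∈ U i)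
    (hcard : ∀ i j e, (U i ∩ {x | deg x = e}).ncard = (U j ∩ {x | deg x = e}).ncard) :
    ∃ B, ∀ i, ∀ x ∈ U i, ∃ y ∈ U i, deg y ≤ B ∧ r y x := by
  have hbound : ∀ V : Set X, ∃ B, ∀ x ∈ V, ∃ y ∈ V, deg y ≤ B ∧ r y x := by
    intro V
    by_contra! hcon
    obtain ⟨f, hfV, hf⟩ := exists_seq_of_forall_finset_exists (· ∈ V) (fun x y => ¬ r x y)
      fun s hs => by
        obtain ⟨x, hx, hxs⟩ := hcon (s.sup deg)
        exact ⟨x, hx, fun y hy => hxs y (hs y hy) (Finset.le_sup hy)⟩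
    obtain ⟨m, n, hmn, h⟩ := hr f
    exact hf m n hmn h
  by_contra! hcon
  choose i x hx hnot using hcon
  let F := Filter.hyperfilter ℕ
  let V : Set X := {z | ∀ᶠ B in (F : Filter ℕ), z ∈ U (i B)}
  obtain ⟨B₀, hB₀⟩ := hbound V
  have hloc : ∀ e, ∀ᶠ B in (F : Filter ℕ), ∀ z ∈ {z | deg z = e}, (z ∈ U (i B) ↔ z ∈ V) := by
    intro e
    rw [Filter.eventually_all_finite (hfin e)]
    intro z _
    by_cases hz : z ∈ V
    · exact Filter.Eventually.mono hz fun B hB => ⟨fun _ => hz, fun _ => hB⟩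
    · have : ∀ᶠ B in (F : Filter ℕ), ¬ z ∈ U (i B) := Ultrafilter.eventually_not.mpr hz
      exact this.mono fun B hB => ⟨fun h => absurd h hB, fun h => absurd h hz⟩
  have hle : ∀ᶠ B in (F : Filter ℕ), ∀ e ∈ Set.Iic B₀, ∀ z ∈ {z | deg z = e},
      (z ∈ U (i B) ↔ z ∈ V) :=
    (Filter.eventually_all_finite (Set.finite_Iic B₀)).mpr fun e _ => hloc e
  have hge : ∀ᶠ B in (F : Filter ℕ), B₀ ≤ B :=
    (Filter.eventually_ge_atTop B₀).filter_mono (Nat.hyperfilter_le_atTop)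
  obtain ⟨B, hB, hBB⟩ := (hle.and hge).exists
  have hsub : V ⊆ U (i B) := by
    intro z hz
    obtain ⟨y, hy, hyB, hyz⟩ := hB₀ z hz
    exact hU _ _ _ hyz ((hB _ hyB y rfl).mpr hy)
  let e := deg (x B)
  obtain ⟨B', hB'⟩ := (hloc e).exists
  have heq : V ∩ {z | deg z = e} = U (i B') ∩ {z | deg z = e} := by
    ext z
    constructor
    · rintro ⟨h1, h2⟩
      exact ⟨(hB' z h2).mpr h1, h2⟩
    · rintro ⟨h1, h2⟩
      exact ⟨(hB' z h2).mp h1, h2⟩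
  have heq' : V ∩ {z | deg z = e} = U (i B) ∩ {z | deg z = e} := by
    refine Set.eq_of_subset_of_ncard_le (Set.inter_subset_inter_left _ hsub) ?_
      ((hfin e).inter_of_right _)
    rw [heq, hcard]
  have hxV : x B ∈ V := by
    have : x B ∈ U (i B) ∩ {z | deg z = e} := ⟨hx B, rfl⟩
    rw [← heq'] at this
    exact this.1
  obtain ⟨y, hy, hyB, hyz⟩ := hB₀ _ hxV
  exact hnot B y (hsub hy) (hyB.trans hBB) hyz

theorem Submodule.fg_of_forall_isMaximal {D A M : Type*} [CommRing D] [CommRing A] [Algebra D A]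
    [AddCommGroup M] [Module A M] (W : Submodule A M)
    (h : ∀ m : Ideal D, m.IsMaximal → ∃ δ ∉ m, ∃ Y : Submodule A M, Y.FG ∧ Y ≤ W ∧
      ∀ w ∈ W, ∃ k : ℕ, algebraMap D A δ ^ k • w ∈ Y) : W.FG := by
  let J : Submodule A M → M → Ideal D := fun Y w =>
    Ideal.comap (algebraMap D A) (Y.comap (LinearMap.toSpanSingleton A M w))
  have hJ : ∀ Y w δ, δ ∈ J Y w ↔ algebraMap D A δ • w ∈ Y := fun Y w δ => Iff.rfl
  have hmono : ∀ Y Y' w, Y ≤ Y' → J Y w ≤ J Y' w := fun Y Y' w hY δ hδ => hY hδ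
  let I : Ideal D :=
    { carrier := {δ | ∃ Y : Submodule A M, Y.FG ∧ Y ≤ W ∧ ∀ w ∈ W, δ ∈ (J Y w).radical}
      zero_mem' := ⟨⊥, Submodule.fg_bot, bot_le, fun w _ => Ideal.zero_mem _⟩
      add_mem' := by
        rintro a b ⟨Y, hY, hYW, ha⟩ ⟨Y', hY', hYW', hb⟩
        exact ⟨Y ⊔ Y', hY.sup hY', sup_le hYW hYW', fun w hw => Ideal.add_mem _
          (Ideal.radical_mono (hmono _ _ w le_sup_left) (ha w hw))
          (Ideal.radical_mono (hmono _ _ w le_sup_right) (hb w hw))⟩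
      smul_mem' := by
        rintro c a ⟨Y, hY, hYW, ha⟩
        exact ⟨Y, hY, hYW, fun w hw => Ideal.mul_mem_left _ _ (ha w hw)⟩ }
  have hI : I = ⊤ := by
    by_contra hne
    obtain ⟨m, hm, hIm⟩ := Ideal.exists_le_maximal I hne
    obtain ⟨δ, hδ, Y, hY, hYW, hw⟩ := h m hm
    refine hδ (hIm ⟨Y, hY, hYW, fun w hwW => ?_⟩)
    obtain ⟨k, hk⟩ := hw w hwW
    exact ⟨k, (hJ _ _ _).mpr (by simpa using hk)⟩
  obtain ⟨Y, hY, hYW, h1⟩ := (Ideal.eq_top_iff_one I).mp hI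
  have : Y = W := by
    refine le_antisymm hYW fun w hw => ?_
    have := h1 w hw
    rw [← Ideal.eq_top_iff_one, Ideal.radical_eq_top, Ideal.eq_top_iff_one, hJ] at this
    simpa using this
  exact this ▸ hY

theorem Submodule.mem_of_forall_isMaximal {D M : Type*} [CommRing D]
    [AddCommGroup M] [Module D M] (Y : Submodule D M) (w : M)
    (h : ∀ m : Ideal D, m.IsMaximal → ∃ δ ∉ m, δ • w ∈ Y) : w ∈ Y := by
  by_contra hw
  have hne : Y.comap (LinearMap.toSpanSingleton D M w) ≠ ⊤ := by
    intro h
    have : (1 : D) ∈ Y.comap (LinearMap.toSpanSingleton D M w) := h ▸ Submodule.mem_top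
    exact hw (by simpa using this)
  obtain ⟨m, hm, hIm⟩ := Ideal.exists_le_maximal _ hne
  obtain ⟨δ, hδ, h⟩ := h m hm
  exact hδ (hIm h)

namespace MvPolynomial

variable {D : Type*} [CommRing D] {ι σ : Type*}

/-- The position of the `i`-th coordinate of a vector of polynomials at an exponent. -/
def position (i : ι) (μ : σ →₀ ℕ) : ι ×ₗ Lex (σ →₀ ℕ) := toLex (i, toLex μ)

/-- Positions of total degree at most `e`. -/
def BoundedPosition (ι σ : Type*) (e : ℕ) : Type _ :=
  {t : ι ×ₗ Lex (σ →₀ ℕ) // (ofLex (ofLex t).2).degree ≤ e}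

noncomputable instance [LinearOrder ι] [LinearOrder σ] (e : ℕ) :
    LinearOrder (BoundedPosition ι σ e) :=
  inferInstanceAs (LinearOrder {t : ι ×ₗ Lex (σ →₀ ℕ) // (ofLex (ofLex t).2).degree ≤ e})

instance [Finite ι] [Finite σ] (e : ℕ) : Finite (BoundedPosition ι σ e) := by
  have := (Finsupp.finite_of_degree_le (σ := σ) e).to_subtype
  let f : BoundedPosition ι σ e → ι × {μ : σ →₀ ℕ | μ.degree ≤ e} :=
    fun t => ((ofLex t.1).1, ⟨ofLex (ofLex t.1).2, t.2⟩)
  refine Finite.of_injective f fun s t h => ?_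
  have h1 := congrArg Prod.fst h
  have h2 := congrArg (fun x => x.2.1) h
  apply Subtype.ext
  apply ofLex.injective
  exact Prod.ext h1 (ofLex.injective h2)

theorem position_lt_add [LinearOrder ι] [LinearOrder σ] {i j : ι} {μ ν κ : σ →₀ ℕ}
    (h : position i (κ + μ) < position j (κ + ν)) : position i μ < position j ν := by
  rw [position, position, Prod.Lex.toLex_lt_toLex] at h ⊢
  rcases h with h | ⟨h1, h2⟩
  · exact Or.inl h
  · refine Or.inr ⟨h1, ?_⟩
    rw [toLex_add, toLex_add] at h2
    exact lt_of_add_lt_add_left h2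

section

variable (D ι σ) in
/-- The vector of polynomials with prescribed coefficients in degrees at most `e`. -/
noncomputable def ofCoeffs [Finite ι] [Finite σ] (e : ℕ) :
    (BoundedPosition ι σ e → D) →ₗ[D] ι → MvPolynomial σ D :=
  letI := Fintype.ofFinite (BoundedPosition ι σ e)
  letI := Classical.decEq ι
  ∑ t : BoundedPosition ι σ e, (LinearMap.single D (fun _ => MvPolynomial σ D) (ofLex t.1).1 ∘ₗ
    monomial (ofLex (ofLex t.1).2)) ∘ₗ LinearMap.proj t

variable [Finite ι] [Finite σ]

theorem coeff_ofCoeffs {e : ℕ} (c : BoundedPosition ι σ e → D) (i : ι) (μ : σ →₀ ℕ)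
    (h : μ.degree ≤ e) : coeff μ (ofCoeffs D ι σ e c i) = c ⟨position i μ, h⟩ := by
  classical
  simp only [ofCoeffs, LinearMap.sum_apply, LinearMap.comp_apply, LinearMap.proj_apply,
    Finset.sum_apply, coeff_sum]
  rw [Finset.sum_eq_single ⟨position i μ, h⟩]
  · simp [position]
  · intro t _ ht
    simp only [LinearMap.single_apply, Pi.single_apply]
    split_ifs with hi
    · rw [coeff_monomial, if_neg]
      rintro rfl
      apply ht
      apply Subtype.ext
      apply ofLex.injective
      exact Prod.ext hi.symm rfl
    · simp
  · intro h'
    exact absurd (@Finset.mem_univ _ (Fintype.ofFinite _) _) h'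

theorem coeff_ofCoeffs_eq_zero {e : ℕ} (c : BoundedPosition ι σ e → D) (i : ι) (μ : σ →₀ ℕ)
    (h : e < μ.degree) : coeff μ (ofCoeffs D ι σ e c i) = 0 := by
  classical
  simp only [ofCoeffs, LinearMap.sum_apply, LinearMap.comp_apply, LinearMap.proj_apply,
    Finset.sum_apply, coeff_sum]
  refine Finset.sum_eq_zero fun t _ => ?_
  simp only [LinearMap.single_apply, Pi.single_apply]
  split_ifs with hi
  · rw [coeff_monomial, if_neg]
    rintro rfl
    exact absurd t.2 (not_le.mpr h)
  · simp

theorem exists_ofCoeffs_eq {e : ℕ} {w : ι → MvPolynomial σ D}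
    (hw : ∀ i μ, e < μ.degree → coeff μ (w i) = 0) : ∃ c, ofCoeffs D ι σ e c = w := by
  refine ⟨fun t => coeff (ofLex (ofLex t.1).2) (w (ofLex t.1).1), ?_⟩
  ext i μ
  by_cases h : μ.degree ≤ e
  · rw [coeff_ofCoeffs _ _ _ h]
    rfl
  · rw [coeff_ofCoeffs_eq_zero _ _ _ (not_le.mp h), hw _ _ (not_le.mp h)]

omit [Finite σ] in
theorem exists_forall_coeff_eq_zero (w : ι → MvPolynomial σ D) :
    ∃ e : ℕ, ∀ i μ, e < μ.degree → coeff μ (w i) = 0 := by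
  have := Fintype.ofFinite ι
  refine ⟨Finset.univ.sup fun i => (w i).totalDegree, fun i μ h => ?_⟩
  apply coeff_eq_zero_of_totalDegree_lt
  rw [← Finsupp.degree_apply]
  exact (Finset.le_sup (f := fun i => (w i).totalDegree) (Finset.mem_univ i)).trans_lt h

end

theorem coeff_monomial_smul {w : ι → MvPolynomial σ D} (κ : σ →₀ ℕ) (i : ι) (ν : σ →₀ ℕ) :
    coeff (κ + ν) ((monomial κ (1 : D) • w) i) = coeff ν (w i) := by
  simp [coeff_monomial_mul]

section Saturated

variable [LinearOrder ι] [LinearOrder σ]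

/-- Homogenized leading positions modulo `m` of the elements of `W`. -/
def leadSet (m : Ideal D) (W : Submodule (MvPolynomial σ D) (ι → MvPolynomial σ D)) :
    Set (ι × ℕ × (σ →₀ ℕ)) :=
  {x | ∃ w ∈ W, (∀ i ν, x.2.1 + x.2.2.degree < ν.degree → coeff ν (w i) = 0) ∧
    coeff x.2.2 (w x.1) ∉ m ∧ ∀ i ν, position x.1 x.2.2 < position i ν → coeff ν (w i) ∈ m}

theorem monomial_smul_leading {m : Ideal D} {w : ι → MvPolynomial σ D} {i : ι} {e j : ℕ}
    {μ κ : σ →₀ ℕ} (hdeg : ∀ i ν, e < ν.degree → coeff ν (w i) = 0) (he : e + κ.degree ≤ j)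
    (hμ : coeff μ (w i) ∉ m) (hlt : ∀ i' ν, position i μ < position i' ν → coeff ν (w i') ∈ m) :
    (∀ i ν, j < ν.degree → coeff ν ((monomial κ (1 : D) • w) i) = 0) ∧
    coeff (κ + μ) ((monomial κ (1 : D) • w) i) ∉ m ∧
    ∀ i' ν, position i (κ + μ) < position i' ν →
      coeff ν ((monomial κ (1 : D) • w) i') ∈ m := by
  refine ⟨fun i' ν hν => ?_, by rwa [coeff_monomial_smul], fun i' ν hν => ?_⟩
  · by_cases h : κ ≤ ν
    · obtain ⟨ν, rfl⟩ := exists_add_of_le h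
      rw [coeff_monomial_smul]
      apply hdeg
      rw [map_add] at hν
      omega
    · simp [coeff_monomial_mul', h]
  · by_cases h : κ ≤ ν
    · obtain ⟨ν, rfl⟩ := exists_add_of_le h
      rw [coeff_monomial_smul]
      exact hlt _ _ (position_lt_add hν)
    · simp [coeff_monomial_mul', h]

theorem mem_leadSet_of_le {m : Ideal D}
    {W : Submodule (MvPolynomial σ D) (ι → MvPolynomial σ D)} {i : ι} {j j' : ℕ} {μ μ' : σ →₀ ℕ}
    (hj : j ≤ j') (hμ : μ ≤ μ') (h : (i, j, μ) ∈ leadSet m W) : (i, j', μ') ∈ leadSet m W := by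
  obtain ⟨κ, rfl⟩ := exists_add_of_le hμ
  obtain ⟨w, hw, hdeg, hlead, hlt⟩ := h
  have := monomial_smul_leading (j := j' + (κ + μ).degree) (κ := κ) hdeg
    (by rw [map_add]; dsimp only; omega) hlead hlt
  rw [add_comm μ κ]
  exact ⟨_, W.smul_mem _ hw, this⟩

variable [Finite ι] [Finite σ]

theorem mem_leadSet_iff {m : Ideal D} {W : Submodule (MvPolynomial σ D) (ι → MvPolynomial σ D)}
    {i : ι} {j e : ℕ} {μ : σ →₀ ℕ} (he : j + μ.degree = e) :
    (i, j, μ) ∈ leadSet m W ↔ (⟨position i μ, he ▸ Nat.le_add_left _ _⟩ : BoundedPosition ι σ e) ∈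
      leadingPositions m ((W.restrictScalars D).comap (ofCoeffs D ι σ e)) := by
  subst he
  constructor
  · rintro ⟨w, hw, hdeg, hlead, hlt⟩
    obtain ⟨c, rfl⟩ := exists_ofCoeffs_eq hdeg
    refine ⟨c, hw, ?_, fun t ht => ?_⟩
    · rwa [coeff_ofCoeffs] at hlead
    · have := hlt (ofLex t.1).1 (ofLex (ofLex t.1).2) ht
      rwa [coeff_ofCoeffs _ _ _ t.2] at this
  · rintro ⟨c, hc, hlead, hlt⟩
    refine ⟨_, hc, fun i ν h => coeff_ofCoeffs_eq_zero _ _ _ h, ?_, fun i' ν h => ?_⟩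
    · rwa [coeff_ofCoeffs]
    · by_cases hν : ν.degree ≤ j + μ.degree
      · rw [coeff_ofCoeffs _ _ _ hν]
        exact hlt _ h
      · rw [coeff_ofCoeffs_eq_zero _ _ _ (not_le.mp hν)]
        exact m.zero_mem

theorem ncard_leadSet (m : Ideal D) (W : Submodule (MvPolynomial σ D) (ι → MvPolynomial σ D))
    (e : ℕ) : (leadSet m W ∩ {x | x.2.1 + x.2.2.degree = e}).ncard =
      Nat.card (leadingPositions m ((W.restrictScalars D).comap (ofCoeffs D ι σ e))) := by
  rw [Nat.card_coe_set_eq]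
  refine Set.ncard_congr (fun x hx => ⟨position x.1 x.2.2, hx.2 ▸ Nat.le_add_left _ _⟩)
    ?_ ?_ ?_
  · rintro ⟨i, j, μ⟩ ⟨hx, he⟩
    exact (mem_leadSet_iff he).mp hx
  · rintro ⟨i, j, μ⟩ ⟨i', j', μ'⟩ ⟨hx, he⟩ ⟨hx', he'⟩ h
    have h2 : i = i' := congrArg (fun t : BoundedPosition ι σ e => (ofLex t.1).1) h
    have h3 : μ = μ' := congrArg (fun t : BoundedPosition ι σ e => ofLex (ofLex t.1).2) h
    subst h2 h3
    have : j = j' := by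
      dsimp at he he'
      omega
    rw [this]
  · intro t ht
    have he : (e - (ofLex (ofLex t.1).2).degree) + (ofLex (ofLex t.1).2).degree = e :=
      Nat.sub_add_cancel t.2
    exact ⟨((ofLex t.1).1, e - (ofLex (ofLex t.1).2).degree, ofLex (ofLex t.1).2),
      ⟨(mem_leadSet_iff he).mpr ht, he⟩, rfl⟩

theorem _root_.Submodule.mvPolynomial_fg_of_saturated [IsDomain D]
    (hD : ∀ m : Ideal D, m.IsMaximal → m.LocallyTotal)
    (W : Submodule (MvPolynomial σ D) (ι → MvPolynomial σ D))
    (hW : ∀ a : D, a ≠ 0 → ∀ w, (C a : MvPolynomial σ D) • w ∈ W → w ∈ W) : W.FG := by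
  classical
  have := Fintype.ofFinite ι
  have hWe : ∀ e, ∀ a : D, a ≠ 0 → ∀ c : BoundedPosition ι σ e → D,
      a • c ∈ (W.restrictScalars D).comap (ofCoeffs D ι σ e) →
      c ∈ (W.restrictScalars D).comap (ofCoeffs D ι σ e) := by
    intro e a ha c hc
    refine hW a ha _ ?_
    rw [Submodule.mem_comap, map_smul] at hc
    have : (C a : MvPolynomial σ D) • ofCoeffs D ι σ e c = a • ofCoeffs D ι σ e c := by
      ext i : 1
      simp [MvPolynomial.smul_eq_C_mul]
    rw [this]
    exact hc
  obtain ⟨B, hB⟩ := WellQuasiOrdered.exists_uniform_bound (X := ι × ℕ × (σ →₀ ℕ))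
    (I := {m : Ideal D // m.IsMaximal}) (r := fun x y => x.1 = y.1 ∧ x.2 ≤ y.2) (by
      have h1 : WellQuasiOrdered (fun x y : ι => x = y) := Finite.wellQuasiOrdered _
      have h2 : WellQuasiOrdered (fun x y : ℕ × (σ →₀ ℕ) => x ≤ y) := wellQuasiOrdered_le
      exact h1.prod h2)
    (fun x => x.2.1 + x.2.2.degree) (by
      intro e
      refine (((Set.finite_univ (α := ι)).prod ((Set.finite_Iic e).prod
        (Finsupp.finite_of_degree_le (σ := σ) e)))).subset ?_
      rintro ⟨i, j, μ⟩ h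
      simp only [Set.mem_ofPred_eq] at h
      simp only [Set.mem_prod, Set.mem_univ, Set.mem_Iic, Set.mem_ofPred_eq, true_and]
      omega)
    (fun m => leadSet m.1 W) (by
      rintro m ⟨i, j, μ⟩ ⟨i', j', μ'⟩ ⟨h1, h2⟩ hx
      dsimp only at h1
      subst h1
      exact mem_leadSet_of_le h2.1 h2.2 hx) (by
      intro m m' e
      have := m.2
      have := m'.2
      rw [ncard_leadSet, ncard_leadSet]
      have := Fintype.ofFinite (BoundedPosition ι σ e)
      have h1 := card_leadingPositions (hD m.1 m.2) (hWe e)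
      rw [← card_leadingPositions (hD m'.1 m'.2) (hWe e)] at h1
      exact_mod_cast h1)
  let V := ((W.restrictScalars D).comap (ofCoeffs D ι σ B)).map (ofCoeffs D ι σ B)
  let Y := Submodule.span (MvPolynomial σ D) (V : Set (ι → MvPolynomial σ D))
  have hVfg : V.FG := by
    refine Submodule.FG.map _ ?_
    refine Submodule.fg_of_forall_isMaximal (D := D) _ fun m hm => ?_
    have := Fintype.ofFinite (BoundedPosition ι σ B)
    choose! v hv using fun s (hs : s ∈ leadingPositions m
      ((W.restrictScalars D).comap (ofCoeffs D ι σ B))) => hs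
    obtain ⟨δ, hδ, h⟩ := exists_smul_mem_span_of_leadingPositions (hD m hm) (hWe B) v hv
    refine ⟨δ, hδ, _, Submodule.fg_span ((Set.toFinite (leadingPositions m
      ((W.restrictScalars D).comap (ofCoeffs D ι σ B)))).image v), ?_, fun w hw => ⟨1, ?_⟩⟩
    · rw [Submodule.span_le]
      rintro _ ⟨s, hs, rfl⟩
      exact (hv s hs).1
    · simpa using h w hw
  have hYfg : Y.FG := by
    obtain ⟨S, hS⟩ := hVfg
    refine ⟨S, le_antisymm (Submodule.span_mono ?_) ?_⟩
    · rw [← hS]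
      exact Submodule.subset_span
    · rw [Submodule.span_le, ← hS]
      exact Submodule.span_le_restrictScalars D (MvPolynomial σ D) (S : Set (ι → MvPolynomial σ D))
  have hYW : Y ≤ W := by
    rw [Submodule.span_le]
    rintro _ ⟨c, hc, rfl⟩
    exact hc
  suffices Y = W from this ▸ hYfg
  refine le_antisymm hYW fun w hw => ?_
  obtain ⟨e, he⟩ := exists_forall_coeff_eq_zero w
  refine Submodule.mem_of_forall_isMaximal (Y.restrictScalars D) w fun m hm => ?_
  have := Fintype.ofFinite (BoundedPosition ι σ e)
  have key : ∀ s ∈ leadingPositions m ((W.restrictScalars D).comap (ofCoeffs D ι σ e)),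
      ∃ v : BoundedPosition ι σ e → D, v ∈ (Y.restrictScalars D).comap (ofCoeffs D ι σ e) ∧
        v s ∉ m ∧ ∀ t, s < t → v t ∈ m := by
    rintro ⟨s, hs⟩ hlead
    obtain ⟨⟨i', j, μ⟩, ⟨w₀, hw₀, hdeg, hl, hlt⟩, hle, hi, hj, hμ⟩ := hB ⟨m, hm⟩
      ((ofLex s).1, e - (ofLex (ofLex s).2).degree, ofLex (ofLex s).2)
      ((mem_leadSet_iff (Nat.sub_add_cancel hs)).mpr hlead)
    dsimp only at hi hj hμ hdeg hl hlt hle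
    obtain ⟨κ, hκ⟩ := exists_add_of_le hμ
    rw [add_comm] at hκ
    have hdd : (ofLex (ofLex s).2).degree = κ.degree + μ.degree := by rw [hκ, map_add]
    obtain ⟨h1, h2, h3⟩ := monomial_smul_leading (κ := κ) (j := e) hdeg (by omega) hl hlt
    obtain ⟨v, hv⟩ := exists_ofCoeffs_eq h1
    obtain ⟨v₀, hv₀⟩ := exists_ofCoeffs_eq (e := B) (w := w₀)
      (fun i ν hν => hdeg i ν (by omega))
    have hs' : s = position i' (κ + μ) := by
      rw [← hκ, hi]
      rfl
    subst hs'
    refine ⟨v, ?_, ?_, fun t ht => ?_⟩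
    · change ofCoeffs D ι σ e v ∈ Y
      rw [hv]
      refine Y.smul_mem _ (Submodule.subset_span ⟨v₀, ?_, hv₀⟩)
      change ofCoeffs D ι σ B v₀ ∈ W
      rwa [hv₀]
    · rw [← hv] at h2
      have h4 := coeff_ofCoeffs v i' (κ + μ) hs
      rwa [h4] at h2
    · have := h3 (ofLex t.1).1 (ofLex (ofLex t.1).2) ht
      rwa [← hv, coeff_ofCoeffs _ _ _ t.2] at this
  choose! v hv using key
  obtain ⟨δ, hδ, h⟩ := exists_smul_mem_span_of_leadingPositions (hD m hm) (hWe e) v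
    fun s hs => ⟨hYW (hv s hs).1, (hv s hs).2⟩
  obtain ⟨c, rfl⟩ := exists_ofCoeffs_eq he
  refine ⟨δ, hδ, ?_⟩
  have h2 : Submodule.span D (v '' leadingPositions m
      ((W.restrictScalars D).comap (ofCoeffs D ι σ e))) ≤
      (Y.restrictScalars D).comap (ofCoeffs D ι σ e) := by
    rw [Submodule.span_le]
    rintro _ ⟨s, hs, rfl⟩
    exact (hv s hs).1
  have h3 := h2 (h c hw)
  rwa [Submodule.mem_comap, map_smul] at h3

end Saturated

end MvPolynomial

/-- Every localization at a maximal ideal is a valuation ring with divisible value group,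
expressed with elements of the ring. -/
structure IsDivisiblePrufer (D : Type*) [CommRing D] : Prop where
  locallyTotal : ∀ m : Ideal D, m.IsMaximal → m.LocallyTotal
  locallyDivisible : ∀ m : Ideal D, m.IsMaximal → m.LocallyDivisible

theorem IsDivisiblePrufer.of_surjective {D E : Type*} [CommRing D] [CommRing E]
    (hD : IsDivisiblePrufer D) (f : D →+* E) (hf : Function.Surjective f) :
    IsDivisiblePrufer E := by
  constructor
  · intro m hm a b
    have := Ideal.comap_isMaximal_of_surjective f hf (K := m)
    obtain ⟨a, rfl⟩ := hf a
    obtain ⟨b, rfl⟩ := hf b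
    obtain ⟨s, hs, c, h⟩ := hD.locallyTotal _ this a b
    refine ⟨f s, hs, f c, ?_⟩
    simp only [← map_mul]
    exact h.imp (congrArg f) (congrArg f)
  · intro m hm a k hk
    have := Ideal.comap_isMaximal_of_surjective f hf (K := m)
    obtain ⟨a, rfl⟩ := hf a
    obtain ⟨y, s, hs, t, ht, h⟩ := hD.locallyDivisible _ this a k hk
    refine ⟨f y, f s, hs, f t, ht, ?_⟩
    simp only [← map_mul, ← map_pow, h]

theorem Ideal.LocallyTotal.valuationRing_localization {R : Type*} [CommRing R] [IsDomain R]
    {p : Ideal R} [p.IsPrime] (h : p.LocallyTotal) : ValuationRing (Localization.AtPrime p) := by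
  suffices PreValuationRing (Localization.AtPrime p) from .mk
  constructor
  intro a b
  obtain ⟨a, s, rfl⟩ := IsLocalization.exists_mk'_eq p.primeCompl a
  obtain ⟨b, t, rfl⟩ := IsLocalization.exists_mk'_eq p.primeCompl b
  obtain ⟨u, hu, c, hc | hc⟩ := h a b
  · refine ⟨IsLocalization.mk' _ (c * t) (⟨u, hu⟩ * s), Or.inr ?_⟩
    rw [← IsLocalization.mk'_mul, IsLocalization.mk'_eq_iff_eq]
    congr 1
    push_cast
    linear_combination (-(t : R) * s) * hc
  · refine ⟨IsLocalization.mk' _ (c * s) (⟨u, hu⟩ * t), Or.inl ?_⟩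
    rw [← IsLocalization.mk'_mul, IsLocalization.mk'_eq_iff_eq]
    congr 1
    push_cast
    linear_combination (-(t : R) * s) * hc

theorem IsDivisiblePrufer.isIntegrallyClosed {D : Type*} [CommRing D] [IsDomain D]
    (hD : IsDivisiblePrufer D) : IsIntegrallyClosed D :=
  IsIntegrallyClosed.of_localization_maximal fun p _ hp => by
    have := (hD.locallyTotal p hp).valuationRing_localization
    infer_instance

instance MvPolynomial.isIntegrallyClosed_fin {D : Type*} [CommRing D] [IsDomain D]
    [IsIntegrallyClosed D] (n : ℕ) : IsIntegrallyClosed (MvPolynomial (Fin n) D) := by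
  induction n with
  | zero => exact IsIntegrallyClosed.of_equiv (MvPolynomial.isEmptyRingEquiv D _).symm
  | succ n ih =>
    exact IsIntegrallyClosed.of_equiv
      (MvPolynomial.finSuccEquiv D n).symm.toRingEquiv

section Gauss

namespace MvPolynomial

variable {D σ : Type*} [CommRing D] {m : Ideal D}

instance isPrime_map_C [m.IsPrime] : (m.map (C : D →+* MvPolynomial σ D)).IsPrime := by
  have := ker_map (σ := σ) (Ideal.Quotient.mk m)
  rw [Ideal.mk_ker] at this
  rw [← this]
  exact RingHom.ker_isPrime _

theorem C_notMem_map_C {a : D} (ha : a ∉ m) : C a ∉ m.map (C : D →+* MvPolynomial σ D) := by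
  classical
  rw [mem_map_C_iff]
  intro h
  exact ha (by simpa using h 0)

theorem exists_C_mul_eq_C_mul [m.IsPrime] [IsDomain D] (hm : m.LocallyTotal)
    {f : MvPolynomial σ D} (hf : f ≠ 0) :
    ∃ s ∉ m, ∃ a ≠ 0, ∃ f₀ ∉ m.map (C : D →+* MvPolynomial σ D), C s * f = C a * f₀ := by
  classical
  obtain ⟨μ, hμ, s, hs, h⟩ := hm.exists_forall_dvd f.support (support_nonempty.mpr hf)
    fun ν => coeff ν f
  have hs0 : s ≠ 0 := fun h => hs (h ▸ m.zero_mem)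
  have hμ0 : coeff μ f ≠ 0 := mem_support_iff.mp hμ
  have hdvd : C (coeff μ f) ∣ C s * f := by
    rw [C_dvd_iff_dvd_coeff]
    intro ν
    rw [coeff_C_mul]
    by_cases hν : ν ∈ f.support
    · obtain ⟨c, hc⟩ := h ν hν
      exact ⟨c, by rw [hc, mul_comm]⟩
    · rw [notMem_support_iff.mp hν, mul_zero]
      exact dvd_zero _
  obtain ⟨f₀, hf₀⟩ := hdvd
  refine ⟨s, hs, coeff μ f, hμ0, f₀, fun hcon => hs ?_, hf₀⟩
  have h1 := congrArg (coeff μ) hf₀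
  rw [coeff_C_mul, coeff_C_mul, mul_comm] at h1
  rw [mul_left_cancel₀ hμ0 h1]
  exact mem_map_C_iff.mp hcon μ

variable [m.IsPrime] [IsDomain D]

theorem locallyTotal_map_C (hm : m.LocallyTotal) :
    (m.map (C : D →+* MvPolynomial σ D)).LocallyTotal := by
  intro f g
  by_cases hf : f = 0
  · exact ⟨1, (Ideal.ne_top_iff_one _).mp isPrime_map_C.ne_top, 0, by simp [hf]⟩
  by_cases hg : g = 0
  · exact ⟨1, (Ideal.ne_top_iff_one _).mp isPrime_map_C.ne_top, 0, by simp [hg]⟩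
  obtain ⟨s, hs, a, -, f₀, hf₀, h1⟩ := exists_C_mul_eq_C_mul hm hf
  obtain ⟨t, ht, b, -, g₀, hg₀, h2⟩ := exists_C_mul_eq_C_mul hm hg
  have hp := isPrime_map_C (σ := σ) (m := m)
  obtain ⟨u, hu, c, h | h⟩ := hm a b
  all_goals
    have h := congrArg (C (σ := σ)) h
    simp only [map_mul] at h
  · refine ⟨C u * C s * g₀, hp.mul_notMem (hp.mul_notMem (C_notMem_map_C hu)
      (C_notMem_map_C hs)) hg₀, C c * f₀ * C t, Or.inl ?_⟩
    linear_combination (C u * g₀) * h1 + (f₀ * g₀) * h - C c * f₀ * h2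
  · refine ⟨C u * C t * f₀, hp.mul_notMem (hp.mul_notMem (C_notMem_map_C hu)
      (C_notMem_map_C ht)) hf₀, C c * g₀ * C s, Or.inr ?_⟩
    linear_combination (C u * f₀) * h2 + (f₀ * g₀) * h - C c * g₀ * h1

theorem locallyDivisible_map_C (hm : m.LocallyTotal) (hm' : m.LocallyDivisible) :
    (m.map (C : D →+* MvPolynomial σ D)).LocallyDivisible := by
  intro f k hk
  have hp := isPrime_map_C (σ := σ) (m := m)
  by_cases hf : f = 0
  · have h1 := (Ideal.ne_top_iff_one _).mp hp.ne_top
    exact ⟨0, 1, h1, 1, h1, by simp [hf, hk]⟩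
  obtain ⟨s, hs, a, -, f₀, hf₀, h1⟩ := exists_C_mul_eq_C_mul hm hf
  obtain ⟨y, u, hu, t, ht, h⟩ := hm' a k hk
  have h := congrArg (C (σ := σ)) h
  simp only [map_mul, map_pow] at h
  refine ⟨C y, C u * f₀, hp.mul_notMem (C_notMem_map_C hu) hf₀, C t * C s,
    hp.mul_notMem (C_notMem_map_C ht) (C_notMem_map_C hs), ?_⟩
  linear_combination f₀ * h - C t * h1

theorem exists_C_dvd_C_mul (hm : m.LocallyTotal) {a : D} {f h : MvPolynomial σ D}
    (hf : f ∉ m.map (C : D →+* MvPolynomial σ D)) (hdvd : C a ∣ f * h) :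
    ∃ δ ∉ m, C a ∣ C δ * h := by
  have hp := isPrime_map_C (σ := σ) (m := m)
  by_cases hh : h = 0
  · exact ⟨1, m.ne_top_iff_one.mp ‹m.IsPrime›.ne_top, by simp [hh]⟩
  obtain ⟨s, hs, b, -, h₀, hh₀, h1⟩ := exists_C_mul_eq_C_mul hm hh
  have h2 := hp.mul_notMem hf hh₀
  rw [mem_map_C_iff] at h2
  push Not at h2
  obtain ⟨ν, hν⟩ := h2
  refine ⟨coeff ν (f * h₀) * s, ‹m.IsPrime›.mul_notMem hν hs, ?_⟩
  have h3 : C a ∣ C b * (f * h₀) := by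
    have : C b * (f * h₀) = C s * (f * h) := by linear_combination -f * h1
    rw [this]
    exact hdvd.mul_left _
  rw [C_dvd_iff_dvd_coeff] at h3
  have h4 := h3 ν
  rw [coeff_C_mul] at h4
  have h5 : C (coeff ν (f * h₀) * s) * h = C (b * coeff ν (f * h₀)) * h₀ := by
    simp only [map_mul]
    linear_combination C (coeff ν (f * h₀)) * h1
  rw [h5]
  exact (map_dvd C h4).mul_right _

end MvPolynomial

end Gauss

theorem exists_mul_eq_of_aeval_eq_zero {N L : Type*} [CommRing N] [Field L]
    [Algebra N L] [FaithfulSMul N L] [IsIntegrallyClosedIn N L] (P : Ideal N) (u : L) (d : ℕ)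
    (g : Polynomial N) (hd : g.natDegree ≤ d) (hg : Polynomial.aeval u g = 0)
    (hP : ∃ i, g.coeff i ∉ P) :
    ∃ b c : N, (b ∉ P ∨ c ∉ P) ∧ u * algebraMap N L c = algebraMap N L b := by
  have hinj : Function.Injective (algebraMap N L) := FaithfulSMul.algebraMap_injective N L
  induction d generalizing g with
  | zero =>
    rw [Polynomial.eq_C_of_natDegree_le_zero hd] at hg hP
    simp only [Polynomial.aeval_C] at hg
    rw [(map_eq_zero_iff _ hinj).mp hg] at hP
    simp at hP
  | succ d ih =>
    by_cases hd' : g.natDegree ≤ d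
    · exact ih g hd' hg hP
    have hdeg : g.natDegree = d + 1 := by omega
    have hint := isIntegral_leadingCoeff_smul g u hg
    obtain ⟨b, hb⟩ := IsIntegrallyClosedIn.isIntegral_iff.mp hint
    rw [Polynomial.leadingCoeff, hdeg, Algebra.smul_def] at hb
    by_cases h : b ∉ P ∨ g.coeff (d + 1) ∉ P
    · exact ⟨b, g.coeff (d + 1), h, by rw [hb, mul_comm]⟩
    push Not at h
    refine ih (g - Polynomial.C (g.coeff (d + 1)) * Polynomial.X ^ (d + 1) +
      Polynomial.C b * Polynomial.X ^ d) ?_ ?_ ?_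
    · refine Polynomial.natDegree_add_le_of_degree_le ?_ (Polynomial.natDegree_C_mul_X_pow_le _ _)
      refine Polynomial.natDegree_le_pred (n := d + 1) ?_ (by simp)
      exact (Polynomial.natDegree_sub_le_of_le hd (Polynomial.natDegree_C_mul_X_pow_le _ _)).trans
        (by simp)
    · simp only [map_add, map_sub, map_mul, map_pow, Polynomial.aeval_C, Polynomial.aeval_X, hg, hb]
      ring
    · obtain ⟨i, hi⟩ := hP
      refine ⟨i, fun hcon => hi ?_⟩
      have hi' : i ≠ d + 1 := fun h' => hi (h' ▸ h.2)
      simp only [Polynomial.coeff_add, Polynomial.coeff_sub, Polynomial.coeff_C_mul,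
        Polynomial.coeff_X_pow, if_neg hi', mul_zero, sub_zero] at hcon
      refine (P.add_mem_iff_left ?_).mp hcon
      exact P.mul_mem_right _ h.1

section

variable {N L : Type*} [CommRing N] [Field L] [Algebra N L]

/-- The local ring of fractions of `N` at a prime `P`, when it is a valuation ring of `L`. -/
def ValuationSubring.ofIdeal (P : Ideal N) [hP : P.IsPrime]
    (h : ∀ u : L, ∃ b c : N, (b ∉ P ∨ c ∉ P) ∧ u * algebraMap N L c = algebraMap N L b) :
    ValuationSubring L where
  carrier := {x | ∃ b c : N, c ∉ P ∧ x * algebraMap N L c = algebraMap N L b}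
  mul_mem' := by
    rintro x y ⟨b, c, hc, hx⟩ ⟨b', c', hc', hy⟩
    exact ⟨b * b', c * c', hP.mul_notMem hc hc', by simp only [map_mul, ← hx, ← hy]; ring⟩
  one_mem' := ⟨1, 1, P.ne_top_iff_one.mp hP.ne_top, by simp⟩
  add_mem' := by
    rintro x y ⟨b, c, hc, hx⟩ ⟨b', c', hc', hy⟩
    exact ⟨b * c' + b' * c, c * c', hP.mul_notMem hc hc', by
      simp only [map_mul, map_add, ← hx, ← hy]; ring⟩
  zero_mem' := ⟨0, 1, P.ne_top_iff_one.mp hP.ne_top, by simp⟩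
  neg_mem' := by
    rintro x ⟨b, c, hc, hx⟩
    exact ⟨-b, c, hc, by simp [← hx]⟩
  mem_or_inv_mem' := by
    intro x
    by_cases hx0 : x = 0
    · exact Or.inl ⟨0, 1, P.ne_top_iff_one.mp hP.ne_top, by simp [hx0]⟩
    obtain ⟨b, c, hb | hc, hx⟩ := h x
    · exact Or.inr ⟨c, b, hb, by rw [← hx]; field_simp⟩
    · exact Or.inl ⟨b, c, hc, hx⟩

variable {P : Ideal N} [hP : P.IsPrime]
  (h : ∀ u : L, ∃ b c : N, (b ∉ P ∨ c ∉ P) ∧ u * algebraMap N L c = algebraMap N L b)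

theorem ValuationSubring.valuation_ofIdeal_le_one (b : N) :
    (ofIdeal P h).valuation (algebraMap N L b) ≤ 1 :=
  (valuation_le_one_iff _ _).mpr ⟨b, 1, P.ne_top_iff_one.mp hP.ne_top, by simp⟩

variable [FaithfulSMul N L]

theorem ValuationSubring.valuation_ofIdeal_eq_one {b : N} (hb : b ∉ P) :
    (ofIdeal P h).valuation (algebraMap N L b) = 1 := by
  have hb0 : algebraMap N L b ≠ 0 := by
    rw [Ne, map_eq_zero_iff _ (FaithfulSMul.algebraMap_injective N L)]
    exact fun h0 => hb (h0 ▸ P.zero_mem)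
  refine le_antisymm (valuation_ofIdeal_le_one h b) ?_
  have h1 : (ofIdeal P h).valuation (algebraMap N L b)⁻¹ ≤ 1 := by
    rw [valuation_le_one_iff]
    exact ⟨1, b, hb, by simp [hb0]⟩
  rw [map_inv₀] at h1
  have := (inv_le_one₀ (zero_lt_iff.mpr ((Valuation.ne_zero_iff _).mpr hb0))).mp h1
  exact this

theorem ValuationSubring.valuation_ofIdeal_lt_one {b : N} (hb : b ∈ P) :
    (ofIdeal P h).valuation (algebraMap N L b) < 1 := by
  by_contra hcon
  have h1 := le_antisymm (valuation_ofIdeal_le_one h b) (not_lt.mp hcon)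
  have h0 : algebraMap N L b ≠ 0 := by
    intro h0
    rw [h0, map_zero] at h1
    exact zero_ne_one h1
  have h2 : (ofIdeal P h).valuation (algebraMap N L b)⁻¹ ≤ 1 := by rw [map_inv₀, h1, inv_one]
  rw [valuation_le_one_iff] at h2
  obtain ⟨b', c, hc, hx⟩ := h2
  apply hc
  have : c = b * b' := by
    apply FaithfulSMul.algebraMap_injective N L
    rw [map_mul, ← hx]
    field_simp
  exact this ▸ P.mul_mem_right _ hb

end

/-- If a sum of nonzero terms vanishes, two of its terms have the same value. -/
theorem Valuation.exists_eq_of_sum_eq_zero {L Γ : Type*} [Field L]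
    [LinearOrderedCommGroupWithZero Γ] (v : Valuation L Γ) {I : Type*} (S : Finset I) (f : I → L)
    (h0 : ∀ i ∈ S, f i ≠ 0) (hS : S.Nonempty) (hf : ∑ i ∈ S, f i = 0) :
    ∃ i ∈ S, ∃ j ∈ S, i ≠ j ∧ v (f i) = v (f j) := by
  classical
  obtain ⟨j, hj, hmax⟩ := S.exists_max_image (fun i => v (f i)) hS
  by_contra! hcon
  have h1 : v (∑ i ∈ S.erase j, f i) < v (f j) := by
    refine v.map_sum_lt ((v.ne_zero_iff).mpr (h0 j hj)) fun i hi => ?_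
    rw [Finset.mem_erase] at hi
    exact lt_of_le_of_ne (hmax i hi.2) (hcon i hi.2 j hj hi.1)
  rw [← Finset.add_sum_erase _ _ hj] at hf
  rw [eq_neg_of_add_eq_zero_right hf, Valuation.map_neg] at h1
  exact lt_irrefl _ h1

section

variable {R F L : Type*} [CommRing R] [IsDomain R] [Field F] [Algebra R F]
  [IsFractionRing R F] [Field L] [Algebra F L] [Algebra R L] [IsScalarTower R F L]
  {q : Ideal R}

theorem exists_primitive_relation [q.IsPrime] [Algebra.IsAlgebraic F L] (hq : q.LocallyTotal)
    (u : L) :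
    ∃ g : Polynomial R, (∃ i, g.coeff i ∉ q) ∧ Polynomial.aeval u g = 0 := by
  have hu : IsAlgebraic R u :=
    (IsFractionRing.isAlgebraic_iff R F L).mpr (Algebra.IsAlgebraic.isAlgebraic u)
  obtain ⟨f, hf0, hf⟩ := hu
  obtain ⟨t₀, ht₀, s, hs, hd⟩ := hq.exists_forall_dvd f.support
    (Polynomial.support_nonempty.mpr hf0) f.coeff
  choose! c hc using hd
  have hinj : Function.Injective (algebraMap R L) := by
    rw [IsScalarTower.algebraMap_eq R F L]
    exact (algebraMap F L).injective.comp (IsFractionRing.injective R F)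
  let g : Polynomial R := ∑ i ∈ f.support, Polynomial.C (c i) * Polynomial.X ^ i
  have hfg : Polynomial.C s * f = Polynomial.C (f.coeff t₀) * g := by
    conv_lhs => rw [f.as_sum_support_C_mul_X_pow]
    simp only [g, Finset.mul_sum]
    refine Finset.sum_congr rfl fun i hi => ?_
    rw [← mul_assoc, ← mul_assoc, ← map_mul, ← map_mul, hc i hi, mul_comm (c i)]
  have ht : f.coeff t₀ ≠ 0 := Polynomial.mem_support_iff.mp ht₀
  refine ⟨g, ⟨t₀, ?_⟩, ?_⟩
  · have h1 := congrArg (fun p => Polynomial.coeff p t₀) hfg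
    simp only [Polynomial.coeff_C_mul] at h1
    rw [mul_comm] at h1
    rwa [← mul_left_cancel₀ ht h1]
  · have h1 := congrArg (Polynomial.aeval u) hfg
    rw [map_mul, hf, mul_zero, map_mul, Polynomial.aeval_C] at h1
    exact (mul_eq_zero.mp h1.symm).resolve_left ((map_ne_zero_iff _ hinj).mpr ht)

/-- The value group does not grow in algebraic extensions when it is divisible. -/
theorem Valuation.exists_algebraMap_eq [Algebra.IsAlgebraic F L] {Γ : Type*}
    [LinearOrderedCommGroupWithZero Γ] (v : Valuation L Γ) (hq' : q.LocallyDivisible)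
    (hv : ∀ s ∉ q, v (algebraMap R L s) = 1) (z : L) (hz : z ≠ 0) :
    ∃ c : F, v z = v (algebraMap F L c) := by
  have hu : IsAlgebraic R z :=
    (IsFractionRing.isAlgebraic_iff R F L).mpr (Algebra.IsAlgebraic.isAlgebraic z)
  obtain ⟨f, hf0, hf⟩ := hu
  have hinj : Function.Injective (algebraMap R L) := by
    rw [IsScalarTower.algebraMap_eq R F L]
    exact (algebraMap F L).injective.comp (IsFractionRing.injective R F)
  have hroot : ∀ (a : R) (k : ℕ), k ≠ 0 → ∃ y : R, v (algebraMap R L y) ^ k =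
      v (algebraMap R L a) := by
    intro a k hk
    obtain ⟨y, s, hs, t, ht, h⟩ := hq' a k hk
    refine ⟨y, ?_⟩
    have h1 := congrArg (fun x => v (algebraMap R L x)) h
    simpa [hv s hs, hv t ht] using h1
  rw [Polynomial.aeval_eq_sum_range] at hf
  have hf2 : ∑ i ∈ f.support, f.coeff i • z ^ i = 0 := by
    rw [← hf]
    refine Finset.sum_subset Polynomial.supp_subset_range_natDegree_succ fun i _ hi => ?_
    rw [Polynomial.notMem_support_iff.mp hi, zero_smul]
  obtain ⟨i, hi, j, hj, hij, h⟩ := v.exists_eq_of_sum_eq_zero _ _ (fun i hi => by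
    rw [Algebra.smul_def]
    refine mul_ne_zero ?_ (pow_ne_zero _ hz)
    rw [Ne, map_eq_zero_iff _ hinj]
    exact Polynomial.mem_support_iff.mp hi) (Polynomial.support_nonempty.mpr hf0) hf2
  wlog hlt : i < j generalizing i j
  · exact this j hj i hi hij.symm h.symm (by omega)
  obtain ⟨k, rfl⟩ := Nat.exists_eq_add_of_lt hlt
  obtain ⟨y, hy⟩ := hroot (f.coeff i) (k + 1) (by omega)
  obtain ⟨y', hy'⟩ := hroot (f.coeff (i + k + 1)) (k + 1) (by omega)
  refine ⟨algebraMap R F y / algebraMap R F y', ?_⟩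
  rw [map_div₀, ← IsScalarTower.algebraMap_apply, ← IsScalarTower.algebraMap_apply, map_div₀]
  refine (pow_left_inj₀ (by simp) (by simp) (Nat.succ_ne_zero k)).mp ?_
  rw [div_pow, Nat.succ_eq_add_one, hy, hy']
  have h0 : v (algebraMap R L (f.coeff (i + k + 1))) ≠ 0 := by
    rw [Valuation.ne_zero_iff, Ne, map_eq_zero_iff _ hinj]
    exact Polynomial.mem_support_iff.mp hj
  have h0' : v z ^ i ≠ 0 := pow_ne_zero _ ((Valuation.ne_zero_iff _).mpr hz)
  simp only [Algebra.smul_def, map_mul, map_pow] at h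
  rw [eq_div_iff h0]
  refine mul_right_cancel₀ h0' ?_
  rw [h, add_assoc, pow_add _ i]
  ac_rfl

/-- Differences `τ b - b` generate an ideal that is not contained in any prime over `q`. -/
theorem exists_mem_span_algEquiv_sub [q.IsPrime] [IsIntegrallyClosed R] [Algebra ℚ R]
    [FiniteDimensional F L] (hq : q.LocallyTotal) (hq' : q.LocallyDivisible) (τ : L ≃ₐ[F] L)
    (hτ : τ ≠ 1) : ∃ f ∉ q, algebraMap R (integralClosure R L) f ∈
      Ideal.span {z : integralClosure R L | ∃ b ∈ integralClosure R L, (z : L) = τ b - b} := by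
  set N := integralClosure R L
  set J := Ideal.span {z : N | ∃ b ∈ N, (z : L) = τ b - b} with hJ
  by_contra! hcon
  obtain ⟨P, hP, hJP, hdisj⟩ := J.exists_le_prime_disjoint
    (q.primeCompl.map (algebraMap R N)) (by
      rw [Set.disjoint_right]
      rintro _ ⟨f, hf, rfl⟩ h
      exact hcon f hf h)
  have hPq : ∀ s ∉ q, algebraMap R N s ∉ P := fun s hs h =>
    Set.disjoint_right.mp hdisj ⟨s, hs, rfl⟩ h
  have : Algebra.IsAlgebraic F L := inferInstance
  have hNL : IsIntegrallyClosedIn N L := inferInstance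
  have hO : ∀ u : L, ∃ b c : N, (b ∉ P ∨ c ∉ P) ∧ u * algebraMap N L c = algebraMap N L b := by
    intro u
    obtain ⟨g, ⟨i, hi⟩, hg⟩ := exists_primitive_relation (F := F) hq u
    refine exists_mul_eq_of_aeval_eq_zero P u _ (g.map (algebraMap R N)) le_rfl ?_
      ⟨i, by rw [Polynomial.coeff_map]; exact hPq _ hi⟩
    rw [Polynomial.aeval_map_algebraMap, hg]
  let O := ValuationSubring.ofIdeal P hO
  let v := O.valuation
  have hvR : ∀ s ∉ q, v (algebraMap R L s) = 1 := fun s hs =>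
    ValuationSubring.valuation_ofIdeal_eq_one hO (hPq s hs)
  have hsub : ∀ x, v x ≤ 1 → v (τ x - x) < 1 := by
    intro x hx
    obtain ⟨b, c, hc, hx⟩ := (ValuationSubring.valuation_le_one_iff _ _).mp hx
    have hN : ∀ b : N, IsIntegral R (τ b) := fun b => b.2.map τ
    let t : N → N := fun b => ⟨τ b, hN b⟩
    have ht : ∀ b : N, t b - b ∈ P := fun b => hJP (Ideal.subset_span ⟨b, b.2, rfl⟩)
    have htc : t c ∉ P := fun h => hc ((P.sub_mem_iff_right h).mp (ht c))
    have hc0 : algebraMap N L c ≠ 0 := by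
      intro h
      have := ValuationSubring.valuation_ofIdeal_eq_one hO hc
      rw [h, map_zero] at this
      exact zero_ne_one this
    have h1 : (τ x - x) * algebraMap N L (c * t c) =
        algebraMap N L ((t b - b) * c - b * (t c - c)) := by
      have hτx : τ x * algebraMap N L (t c) = algebraMap N L (t b) := by
        have := congrArg τ hx
        rwa [map_mul] at this
      simp only [map_mul, map_sub]
      linear_combination (algebraMap N L c) * hτx - (algebraMap N L (t c)) * hx
    have h2 := congrArg v h1
    rw [map_mul, ValuationSubring.valuation_ofIdeal_eq_one hO (hP.mul_notMem hc htc),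
      mul_one] at h2
    rw [h2]
    exact ValuationSubring.valuation_ofIdeal_lt_one hO
      (P.sub_mem (P.mul_mem_right _ (ht b)) (P.mul_mem_left _ (ht c)))
  obtain ⟨w, hw⟩ : ∃ w, τ w ≠ w := by
    by_contra! h
    exact hτ (AlgEquiv.ext h)
  have hz : τ w - w ≠ 0 := sub_ne_zero.mpr hw
  obtain ⟨c, hc⟩ := v.exists_algebraMap_eq (F := F) hq' hvR _ hz
  have hc0 : algebraMap F L c ≠ 0 := by
    rw [← v.ne_zero_iff, ← hc, v.ne_zero_iff]
    exact hz
  let u := (τ w - w) / algebraMap F L c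
  have hu : v u = 1 := by
    rw [map_div₀, hc, div_self]
    exact v.ne_zero_iff.mpr hc0
  have hpow : ∀ i : ℕ, v ((τ ^ i) u - u) < 1 := by
    intro i
    induction i with
    | zero => simp
    | succ i ih =>
      have h1 : v ((τ ^ i) u) ≤ 1 := by
        have : (τ ^ i) u = ((τ ^ i) u - u) + u := by ring
        rw [this]
        exact v.map_add_le ih.le hu.le
      have h2 := hsub _ h1
      have : (τ ^ (i + 1)) u - u = (τ ((τ ^ i) u) - (τ ^ i) u) + ((τ ^ i) u - u) := by
        rw [pow_succ', AlgEquiv.mul_apply]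
        ring
      rw [this]
      exact v.map_add_lt h2 ih
  let n := orderOf τ
  have hn : n ≠ 0 := (orderOf_pos τ).ne'
  have hsum : ∑ i ∈ Finset.range n, (τ ^ i) u = 0 := by
    have h1 : ∀ i, (τ ^ i) u = ((τ ^ (i + 1)) w - (τ ^ i) w) / algebraMap F L c := by
      intro i
      simp only [u, map_div₀, map_sub, AlgEquiv.commutes]
      rw [pow_succ, AlgEquiv.mul_apply]
    simp only [h1]
    rw [← Finset.sum_div, Finset.sum_range_sub (fun i => (τ ^ i) w), pow_orderOf_eq_one]
    simp
  have hlt : v (∑ i ∈ Finset.range n, ((τ ^ i) u - u)) < 1 :=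
    v.map_sum_lt one_ne_zero fun i _ => hpow i
  rw [Finset.sum_sub_distrib, hsum, zero_sub, Valuation.map_neg, Finset.sum_const,
    Finset.card_range, nsmul_eq_mul, map_mul, hu, mul_one] at hlt
  have hnq : (n : R) ∉ q := by
    intro h
    have h1 : (n : R) * algebraMap ℚ R (n : ℚ)⁻¹ = 1 := by
      rw [← map_natCast (algebraMap ℚ R), ← map_mul, mul_inv_cancel₀ (by exact_mod_cast hn),
        map_one]
    exact ‹q.IsPrime›.ne_top ((Ideal.eq_top_iff_one q).mpr (h1 ▸ q.mul_mem_right _ h))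
  have h3 := hvR _ hnq
  rw [map_natCast] at h3
  exact hlt.ne h3

end

section

variable {R F L : Type*} [CommRing R] [IsDomain R] [IsIntegrallyClosed R] [Algebra ℚ R] [Field F]
  [Algebra R F] [IsFractionRing R F] [Field L] [Algebra F L] [Algebra R L] [IsScalarTower R F L]
  [FiniteDimensional F L] {q : Ideal R} [q.IsPrime]

theorem exists_separating_function (hq : q.LocallyTotal) (hq' : q.LocallyDivisible)
    (τ : L ≃ₐ[F] L) (hτ : τ ≠ 1) : ∃ s ∉ q, ∃ e ∈ Algebra.adjoin (integralClosure R L)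
      (Set.range fun (y : integralClosure R L) (ρ : L ≃ₐ[F] L) => ρ y),
      e 1 = algebraMap R L s ∧ e τ = 0 := by
  obtain ⟨s, hs, h⟩ := exists_mem_span_algEquiv_sub hq hq' τ hτ
  set N := integralClosure R L
  suffices ∀ z ∈ Ideal.span {z : N | ∃ b ∈ N, (z : L) = τ b - b}, ∃ e ∈ Algebra.adjoin N
      (Set.range fun (y : N) (ρ : L ≃ₐ[F] L) => ρ y), e 1 = algebraMap N L z ∧ e τ = 0 by
    exact ⟨s, hs, this _ h⟩
  intro z hz
  induction hz using Submodule.span_induction with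
  | mem z hz =>
    obtain ⟨b, hb, hz⟩ := hz
    let c : N := ⟨τ b, IsIntegral.map τ hb⟩
    refine ⟨algebraMap N _ c - fun ρ : L ≃ₐ[F] L => ρ b, Subalgebra.sub_mem _
      (Subalgebra.algebraMap_mem _ _) (Algebra.subset_adjoin ⟨⟨b, hb⟩, rfl⟩), ?_, ?_⟩
    · exact hz.symm
    · exact sub_self (τ b)
  | zero => exact ⟨0, Subalgebra.zero_mem _, by simp, rfl⟩
  | add x y _ _ hx hy =>
    obtain ⟨e, he, h1, h2⟩ := hx
    obtain ⟨e', he', h1', h2'⟩ := hy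
    exact ⟨e + e', Subalgebra.add_mem _ he he', by simp [h1, h1'], by simp [h2, h2']⟩
  | smul a x _ hx =>
    obtain ⟨e, he, h1, h2⟩ := hx
    exact ⟨a • e, Subalgebra.smul_mem _ he a, by simp [h1, Algebra.smul_def], by simp [h2]⟩

theorem exists_smul_mem_span_integralClosure [IsGalois F L] (hq : q.LocallyTotal)
    (hq' : q.LocallyDivisible) : ∃ f ∉ q, ∃ S : Finset L, (∀ x ∈ S, IsIntegral R x) ∧
      ∀ b : L, IsIntegral R b → f • b ∈ Submodule.span R (S : Set L) := by
  classical
  choose! s hs e he he1 he0 using fun τ hτ => exists_separating_function (R := R) (F := F) (L := L)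
    hq hq' τ hτ
  set N := integralClosure R L
  let E := ∏ τ ∈ Finset.univ.erase 1, e τ
  have hE : E ∈ Algebra.adjoin N (Set.range fun (y : N) (ρ : L ≃ₐ[F] L) => ρ y) :=
    Subalgebra.prod_mem _ fun τ hτ => he τ (Finset.ne_of_mem_erase hτ)
  have hE1 : E 1 = algebraMap R L (∏ τ ∈ Finset.univ.erase 1, s τ) := by
    rw [show E 1 = _ from Finset.prod_apply _ _ _, map_prod]
    exact Finset.prod_congr rfl fun τ hτ => he1 τ (Finset.ne_of_mem_erase hτ)
  have hE0 : ∀ τ, τ ≠ 1 → E τ = 0 := by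
    intro τ hτ
    rw [show E τ = _ from Finset.prod_apply _ _ _]
    exact Finset.prod_eq_zero (Finset.mem_erase.mpr ⟨hτ, Finset.mem_univ τ⟩) (he0 τ hτ)
  let ev : N →* ((L ≃ₐ[F] L) → L) :=
    { toFun := fun y ρ => ρ y
      map_one' := by ext; simp
      map_mul' := fun _ _ => by ext; simp }
  have hspan : E ∈ Submodule.span N (Set.range ev) := by
    have h1 : Subalgebra.toSubmodule (Algebra.adjoin N (Set.range ev)) =
        Submodule.span N (Set.range ev) := by
      rw [Algebra.adjoin_eq_span, ← MonoidHom.coe_mrange, Submonoid.closure_eq]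
    rw [← h1]
    exact hE
  obtain ⟨c, hc⟩ := (Finsupp.mem_span_range_iff_exists_finsupp).mp hspan
  refine ⟨∏ τ ∈ Finset.univ.erase 1, s τ, ?_, c.support.image fun y => (c y : L), ?_,
    fun b hb => ?_⟩
  · rw [Ideal.IsPrime.prod_mem_iff]
    rintro ⟨τ, hτ, h⟩
    exact hs τ (Finset.ne_of_mem_erase hτ) h
  · intro x hx
    obtain ⟨y, -, rfl⟩ := Finset.mem_image.mp hx
    exact (c y).2
  · have hb' : (∏ τ ∈ Finset.univ.erase 1, s τ) • b = ∑ τ : L ≃ₐ[F] L, E τ * τ b := by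
      rw [Finset.sum_eq_single 1]
      · rw [hE1, Algebra.smul_def]
        rfl
      · intro τ _ hτ
        rw [hE0 τ hτ, zero_mul]
      · intro h
        exact absurd (Finset.mem_univ _) h
    have hEτ : ∀ τ, E τ = ∑ y ∈ c.support, (c y : L) * τ y := by
      intro τ
      rw [← hc, Finsupp.sum, Finset.sum_apply]
      rfl
    have hb2 : (∏ τ ∈ Finset.univ.erase 1, s τ) • b =
        ∑ y ∈ c.support, (c y : L) * algebraMap F L (Algebra.trace F L (y * b)) := by
      rw [hb']
      simp only [hEτ, Finset.sum_mul, trace_eq_sum_automorphisms, Finset.mul_sum, map_mul]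
      rw [Finset.sum_comm]
      simp only [mul_assoc]
    rw [hb2]
    refine Submodule.sum_mem _ fun y hy => ?_
    have hint : IsIntegral R (Algebra.trace F L (y * b)) :=
      Algebra.isIntegral_trace (IsIntegral.mul y.2 hb)
    obtain ⟨r, hr⟩ := IsIntegrallyClosed.isIntegral_iff.mp hint
    rw [← hr, ← IsScalarTower.algebraMap_apply, mul_comm, ← Algebra.smul_def]
    exact Submodule.smul_mem _ _ (Submodule.subset_span (by
      rw [Finset.coe_image]
      exact ⟨y, hy, rfl⟩))

end

theorem fg_integralClosure_of_fg_extension {R L Ω : Type*} [CommRing R] [Algebra ℚ R] [Field L]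
    [Field Ω] [Algebra R L] [Algebra R Ω] [Algebra L Ω] [IsScalarTower R L Ω]
    [FiniteDimensional L Ω] (h : (Subalgebra.toSubmodule (integralClosure R Ω)).FG) :
    (Subalgebra.toSubmodule (integralClosure R L)).FG := by
  have key : Subalgebra.toSubmodule (integralClosure R L) =
      (Subalgebra.toSubmodule (integralClosure R Ω)).map
        ((Algebra.trace L Ω).restrictScalars R) := by
    refine le_antisymm (fun x hx => ?_) ?_
    · set n := Module.finrank L Ω
      have hn : (n : ℚ) ≠ 0 := Nat.cast_ne_zero.mpr Module.finrank_pos.ne'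
      have hn1 : (n : R) * algebraMap ℚ R (n : ℚ)⁻¹ = 1 := by
        rw [← map_natCast (algebraMap ℚ R), ← map_mul, mul_inv_cancel₀ hn, map_one]
      have hx' : IsIntegral R x := hx
      refine ⟨algebraMap ℚ R (n : ℚ)⁻¹ • algebraMap L Ω x, (hx'.algebraMap).smul _, ?_⟩
      rw [map_smul]
      change _ • Algebra.trace L Ω _ = x
      rw [Algebra.trace_algebraMap, ← Nat.cast_smul_eq_nsmul R, smul_smul, mul_comm, hn1, one_smul]
    · rintro _ ⟨y, hy, rfl⟩
      exact Algebra.isIntegral_trace hy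
  exact key ▸ h.map _

section ReflexiveHull

open MvPolynomial

variable {D σ ι F : Type*} [CommRing D] [IsDomain D] [Field F]
  [Algebra (MvPolynomial σ D) F] [FaithfulSMul (MvPolynomial σ D) F]

local notation "𝓡" => MvPolynomial σ D

theorem fg_comap_range_compLeft [Finite σ] [Finite ι]
    (hD : ∀ m : Ideal D, m.IsMaximal → m.LocallyTotal)
    {X : Type*} [AddCommGroup X] [Module F X] [Module 𝓡 X] [IsScalarTower 𝓡 F X]
    (g : X →ₗ[F] (ι → F)) (hg : Function.Injective g) :
    ((LinearMap.range ((Algebra.linearMap 𝓡 F).compLeft ι)).comap (g.restrictScalars 𝓡)).FG := by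
  classical
  let := linearOrderOfSTO (WellOrderingRel (α := ι))
  let := linearOrderOfSTO (WellOrderingRel (α := σ))
  set p := (Algebra.linearMap 𝓡 F).compLeft ι
  set q := g.restrictScalars 𝓡
  have hW : ((LinearMap.range q).comap p).FG := by
    refine Submodule.mvPolynomial_fg_of_saturated hD _ fun a ha w hw => ?_
    obtain ⟨x, hx⟩ := hw
    have ha' : algebraMap 𝓡 F (C a) ≠ 0 := by
      rw [map_ne_zero_iff _ (FaithfulSMul.algebraMap_injective 𝓡 F)]
      simpa using ha
    refine ⟨(algebraMap 𝓡 F (C a))⁻¹ • x, ?_⟩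
    change g _ = _
    rw [map_smul, inv_smul_eq_iff₀ ha', algebraMap_smul]
    rw [map_smul] at hx
    exact hx
  refine Submodule.fg_of_fg_map_injective q hg ?_
  rw [Submodule.map_comap_eq, inf_comm, ← Submodule.map_comap_eq]
  exact hW.map p

theorem exists_finset_forall_C_smul_mem_span [Finite σ] [Finite ι]
    {X : Type*} [AddCommGroup X] [Module F X] [Module 𝓡 X] [IsScalarTower 𝓡 F X]
    (g : X →ₗ[F] (ι → F)) (hg : Function.Injective g) (N : Submodule 𝓡 X)
    (hN : N ≤ (LinearMap.range ((Algebra.linearMap 𝓡 F).compLeft ι)).comap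
      (g.restrictScalars 𝓡)) :
    ∃ S : Finset X, (S : Set X) ⊆ N ∧
      ∀ x ∈ N, ∃ a : D, a ≠ 0 ∧ (C a : 𝓡) • x ∈ Submodule.span 𝓡 (S : Set X) := by
  classical
  let K := FractionRing D
  let RK := MvPolynomial σ K
  let p := (Algebra.linearMap 𝓡 F).compLeft ι
  have hN' : ∀ x ∈ N, ∃ w : ι → 𝓡, p w = g x := hN
  choose! h hh using hN'
  let θ : 𝓡 →+* RK := map (algebraMap D K)
  have hθ : Function.Injective θ := map_injective _ (IsFractionRing.injective D K)
  let : Algebra 𝓡 RK := θ.toAlgebra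
  have hp : Function.Injective p := (FaithfulSMul.algebraMap_injective 𝓡 F).comp_left
  let t : (ι → 𝓡) →ₗ[𝓡] (ι → RK) := (Algebra.linearMap 𝓡 RK).compLeft ι
  have ht : Function.Injective t := hθ.comp_left
  have hfg : (Submodule.span RK ((fun x => t (h x)) '' N)).FG := IsNoetherian.noetherian _
  rw [Submodule.fg_span_iff_fg_span_finset_subset] at hfg
  obtain ⟨S', hS', hspan⟩ := hfg
  obtain ⟨S, hS, rfl⟩ := Finset.subset_set_image_iff.mp hS'
  refine ⟨S, hS, fun x hx => ?_⟩
  have h1 : t (h x) ∈ Submodule.span RK ((fun x => t (h x)) '' N) :=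
    Submodule.subset_span ⟨x, hx, rfl⟩
  rw [hspan] at h1
  have hloc : IsLocalization ((nonZeroDivisors D).map (C : D →+* 𝓡)) RK :=
    MvPolynomial.isLocalization (nonZeroDivisors D) K
  obtain ⟨⟨_, a, ha, rfl⟩, h2⟩ := multiple_mem_span_of_mem_localization_span
    ((nonZeroDivisors D).map (C : D →+* 𝓡)) RK _ _ h1
  refine ⟨a, nonZeroDivisors.ne_zero ha, ?_⟩
  have h3 : (C a : 𝓡) • h x ∈ Submodule.span 𝓡 (h '' S) := by
    rw [Finset.coe_image, ← Set.image_image t h, ← Submodule.map_span] at h2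
    obtain ⟨y, hy, hyx⟩ := h2
    have : y = (C a : 𝓡) • h x := ht (by rw [hyx, map_smul]; rfl)
    rwa [← this]
  have h4 : p ((C a : 𝓡) • h x) ∈ Submodule.span 𝓡 (g.restrictScalars 𝓡 '' S) := by
    have h5 := Submodule.mem_map_of_mem (f := p) h3
    rwa [Submodule.map_span, Set.image_image, Set.image_congr (g := g.restrictScalars 𝓡)
      fun y hy => hh y (hS hy)] at h5
  rw [map_smul, hh x hx, ← Submodule.map_span] at h4
  obtain ⟨y, hy, hyx⟩ := h4
  have : y = (C a : 𝓡) • x := hg (by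
    change g.restrictScalars 𝓡 y = g.restrictScalars 𝓡 ((C a : 𝓡) • x)
    rw [hyx, map_smul]
    rfl)
  rwa [← this]

section Galois

variable {L : Type*} [Field L] [Algebra F L] [FiniteDimensional F L]
variable [Finite σ] [IsFractionRing (MvPolynomial σ D) F] [Algebra (MvPolynomial σ D) L]
  [IsScalarTower (MvPolynomial σ D) F L] [IsIntegrallyClosed (MvPolynomial σ D)]

theorem exists_integralClosure_C_smul_mem_span [Algebra.IsSeparable F L] :
    ∃ S : Finset L, (∀ s ∈ S, IsIntegral 𝓡 s) ∧
      ∀ x : L, IsIntegral 𝓡 x → ∃ a : D, a ≠ 0 ∧ (C a : 𝓡) • x ∈ Submodule.span 𝓡 (S : Set L) := by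
  obtain ⟨s, b, hb⟩ := FiniteDimensional.exists_is_basis_integral 𝓡 F L
  let g : L →ₗ[F] (s → F) := LinearMap.pi fun i => Algebra.traceForm F L (b i)
  have hg : Function.Injective g := by
    rw [injective_iff_map_eq_zero]
    intro x hx
    refine (traceForm_nondegenerate F L).2 x fun y => ?_
    have : (Algebra.traceForm F L).flip x = 0 := b.ext fun i => congrFun hx i
    exact LinearMap.congr_fun this y
  obtain ⟨S, hS, h⟩ := exists_finset_forall_C_smul_mem_span (D := D) (σ := σ) g hg
    (Subalgebra.toSubmodule (integralClosure 𝓡 L)) (fun x hx => by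
      have : ∀ i, ∃ r : 𝓡, algebraMap 𝓡 F r = g x i := fun i =>
        IsIntegrallyClosed.isIntegral_iff.mp
          (Algebra.isIntegral_trace (IsIntegral.mul (hb i) hx))
      choose r hr using this
      exact ⟨r, funext hr⟩)
  exact ⟨S, hS, h⟩

omit [FaithfulSMul (MvPolynomial σ D) F] [Finite σ] in
theorem exists_integralClosure_locally_smul_mem_span [Algebra ℚ D] [IsGalois F L]
    (hD : IsDivisiblePrufer D) :
    ∃ S : Finset L, (∀ s ∈ S, IsIntegral 𝓡 s) ∧
      ∀ m : Ideal D, m.IsMaximal → ∃ f ∉ m.map (C : D →+* 𝓡), ∀ x : L, IsIntegral 𝓡 x →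
        f • x ∈ Submodule.span 𝓡 (S : Set L) := by
  classical
  let T : Set D := {c | ∃ f : 𝓡, ∃ ν, coeff ν f = c ∧ ∃ S : Finset L, (∀ s ∈ S, IsIntegral 𝓡 s) ∧
    ∀ x : L, IsIntegral 𝓡 x → f • x ∈ Submodule.span 𝓡 (S : Set L)}
  have hT : Ideal.span T = ⊤ := by
    by_contra hne
    obtain ⟨m, hm, hTm⟩ := Ideal.exists_le_maximal _ hne
    obtain ⟨f, hf, S, hS, h⟩ := exists_smul_mem_span_integralClosure (R := 𝓡) (F := F) (L := L)
      (q := m.map C) (locallyTotal_map_C (hD.locallyTotal m hm))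
      (locallyDivisible_map_C (hD.locallyTotal m hm) (hD.locallyDivisible m hm))
    rw [mem_map_C_iff] at hf
    push Not at hf
    obtain ⟨ν, hν⟩ := hf
    exact hν (hTm (Ideal.subset_span ⟨f, ν, rfl, S, hS, h⟩))
  have h1 : (1 : D) ∈ Ideal.span T := hT ▸ Submodule.mem_top
  obtain ⟨T', hT', h1'⟩ := Submodule.mem_span_finite_of_mem_span h1
  have hT'' : ∀ c ∈ T', c ∈ T := hT'
  choose! f ν hν S hS h using hT''
  refine ⟨T'.biUnion S, fun s hs => ?_, fun m hm => ?_⟩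
  · obtain ⟨c, hc, hs⟩ := Finset.mem_biUnion.mp hs
    exact hS c hc s hs
  · have : ∃ c ∈ T', c ∉ m := by
      by_contra! hcon
      exact m.ne_top_iff_one.mp hm.ne_top ((Ideal.span_le (I := m)).mpr hcon h1')
    obtain ⟨c, hc, hcm⟩ := this
    refine ⟨f c, fun hf => hcm ?_, fun x hx => Submodule.span_mono ?_ (h c hc x hx)⟩
    · rw [← hν c hc]
      exact mem_map_C_iff.mp hf _
    · exact_mod_cast Finset.subset_biUnion_of_mem S hc

theorem fg_integralClosure_of_isGalois [Algebra ℚ D] [IsGalois F L] (hD : IsDivisiblePrufer D) :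
    (Subalgebra.toSubmodule (integralClosure 𝓡 L)).FG := by
  classical
  obtain ⟨S₁, hS₁, h₁⟩ := exists_integralClosure_C_smul_mem_span (D := D) (σ := σ) (F := F) (L := L)
  obtain ⟨S₂, hS₂, h₂⟩ := exists_integralClosure_locally_smul_mem_span (σ := σ) (F := F) (L := L) hD
  obtain ⟨S, hS, hgen, hloc⟩ : ∃ S : Finset L, (∀ s ∈ S, IsIntegral 𝓡 s) ∧
      (∀ x : L, IsIntegral 𝓡 x → ∃ a : D, a ≠ 0 ∧ (C a : 𝓡) • x ∈ Submodule.span 𝓡 (S : Set L)) ∧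
      ∀ m : Ideal D, m.IsMaximal → ∃ f ∉ m.map (C : D →+* 𝓡), ∀ x : L, IsIntegral 𝓡 x →
        f • x ∈ Submodule.span 𝓡 (S : Set L) := by
    refine ⟨S₁ ∪ S₂, fun s hs => (Finset.mem_union.mp hs).elim (hS₁ s) (hS₂ s), ?_, ?_⟩
    · intro x hx
      obtain ⟨a, ha, h⟩ := h₁ x hx
      exact ⟨a, ha, Submodule.span_mono (by simp) h⟩
    · intro m hm
      obtain ⟨f, hf, h⟩ := h₂ m hm
      exact ⟨f, hf, fun x hx => Submodule.span_mono (by simp) (h x hx)⟩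
  have hspanF : ∀ φ : L →ₗ[F] F, (∀ s ∈ S, φ s = 0) → φ = 0 := by
    intro φ hφ
    ext x
    obtain ⟨y, hy, hyx⟩ := exists_integral_multiples 𝓡 F {x}
    obtain ⟨a, ha, h⟩ := hgen _ (hyx x (Finset.mem_singleton_self x))
    have h2 : Submodule.span 𝓡 (S : Set L) ≤ LinearMap.ker (φ.restrictScalars 𝓡) :=
      Submodule.span_le.mpr fun s hs => hφ s hs
    have h3 : φ.restrictScalars 𝓡 ((C a : 𝓡) • y • x) = 0 := h2 h
    rw [map_smul, map_smul, smul_eq_zero, smul_eq_zero] at h3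
    exact (h3.resolve_left (by simpa using ha)).resolve_left hy
  let M := (LinearMap.range ((Algebra.linearMap 𝓡 F).compLeft S)).comap
    ((LinearMap.pi fun s : S => LinearMap.applyₗ (R := F) (M₂ := F) (s : L)).restrictScalars 𝓡)
  have hMfg : M.FG := by
    refine fg_comap_range_compLeft hD.locallyTotal _ ?_
    rw [injective_iff_map_eq_zero]
    intro φ hφ
    exact hspanF φ fun s hs => congrFun hφ ⟨s, hs⟩
  have hM : ∀ φ : L →ₗ[F] F, φ ∈ M ↔ ∀ s ∈ S, ∃ r : 𝓡, algebraMap 𝓡 F r = φ s := by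
    intro φ
    constructor
    · rintro ⟨w, hw⟩ s hs
      exact ⟨w ⟨s, hs⟩, congrFun hw ⟨s, hs⟩⟩
    · intro h
      choose! w hw using h
      exact ⟨fun s => w s, funext fun s => hw s s.2⟩
  have hMspan : ∀ z : L, (∀ φ ∈ M, φ z = 0) → z = 0 := by
    intro z hz
    refine (Module.forall_dual_apply_eq_zero_iff F z).mp fun φ => ?_
    obtain ⟨r, hr⟩ := IsLocalization.exist_integer_multiples_of_finset (nonZeroDivisors 𝓡)
      (S.image φ)
    have h1 : (r : 𝓡) • φ ∈ M := (hM _).mpr fun s hs => hr _ (Finset.mem_image_of_mem φ hs)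
    have h2 := hz _ h1
    rw [LinearMap.smul_apply, smul_eq_zero] at h2
    exact h2.resolve_left (nonZeroDivisors.ne_zero r.2)
  have hMint : ∀ φ ∈ M, ∀ x : L, IsIntegral 𝓡 x → ∃ r : 𝓡, algebraMap 𝓡 F r = φ x := by
    intro φ hφ x hx
    have hspan : ∀ y ∈ Submodule.span 𝓡 (S : Set L), ∃ r : 𝓡, algebraMap 𝓡 F r = φ y := by
      have : Submodule.span 𝓡 (S : Set L) ≤ (LinearMap.range (Algebra.linearMap 𝓡 F)).comap
        (φ.restrictScalars 𝓡) := Submodule.span_le.mpr ((hM φ).mp hφ)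
      exact this
    obtain ⟨a, ha, h⟩ := hgen x hx
    obtain ⟨g, hg⟩ := hspan _ h
    have hCa : (C a : 𝓡) ≠ 0 := by simpa using ha
    have hdvd : g ∈ (Ideal.span {(C a : 𝓡)}).restrictScalars D := by
      refine Submodule.mem_of_forall_isMaximal _ _ fun m hm => ?_
      obtain ⟨f, hf, hfx⟩ := hloc m hm
      obtain ⟨k, hk⟩ := hspan _ (hfx x hx)
      have h1 : f * g = C a * k := by
        apply IsFractionRing.injective 𝓡 F
        rw [map_mul, map_mul, hg, hk, ← Algebra.smul_def, ← Algebra.smul_def,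
          φ.map_smul_of_tower, φ.map_smul_of_tower, smul_comm]
      obtain ⟨δ, hδ, h2⟩ := exists_C_dvd_C_mul (hD.locallyTotal m hm) hf ⟨k, h1⟩
      refine ⟨δ, hδ, Ideal.mem_span_singleton.mpr ?_⟩
      rwa [← C_mul']
    obtain ⟨r, hr⟩ := Ideal.mem_span_singleton.mp hdvd
    refine ⟨r, ?_⟩
    rw [hr, φ.map_smul_of_tower, map_mul, Algebra.smul_def] at hg
    exact mul_left_cancel₀ ((map_ne_zero_iff _ (IsFractionRing.injective 𝓡 F)).mpr hCa) hg
  obtain ⟨Φ, hΦ⟩ := hMfg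
  let N := (LinearMap.range ((Algebra.linearMap 𝓡 F).compLeft Φ)).comap
    ((LinearMap.pi fun φ : Φ => (φ : L →ₗ[F] F)).restrictScalars 𝓡)
  have hN : ∀ z, z ∈ N ↔ ∀ φ ∈ M, ∃ r : 𝓡, algebraMap 𝓡 F r = φ z := by
    intro z
    constructor
    · rintro ⟨w, hw⟩
      have : M ≤ (LinearMap.range (Algebra.linearMap 𝓡 F)).comap
          ((LinearMap.applyₗ (R := F) (M₂ := F) z).restrictScalars 𝓡) := by
        rw [← hΦ, Submodule.span_le]
        intro φ hφ
        exact ⟨w ⟨φ, hφ⟩, congrFun hw ⟨φ, hφ⟩⟩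
      exact this
    · intro h
      have h' : ∀ φ : Φ, ∃ r : 𝓡, algebraMap 𝓡 F r = φ.1 z := fun φ =>
        h _ (hΦ ▸ Submodule.subset_span φ.2)
      choose w hw using h'
      exact ⟨w, funext hw⟩
  have hNfg : N.FG := by
    refine fg_comap_range_compLeft hD.locallyTotal _ ?_
    rw [injective_iff_map_eq_zero]
    intro z hz
    refine hMspan z fun φ hφ => ?_
    have : M ≤ LinearMap.ker ((LinearMap.applyₗ (R := F) (M₂ := F) z).restrictScalars 𝓡) := by
      rw [← hΦ, Submodule.span_le]
      intro φ hφ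
      exact congrFun hz ⟨φ, hφ⟩
    exact this hφ
  have hNint : ∀ z, IsIntegral 𝓡 z → z ∈ N := fun z hz => (hN z).mpr fun φ hφ => hMint φ hφ z hz
  have hmulM : ∀ z ∈ N, ∀ φ ∈ M, φ ∘ₗ LinearMap.mulLeft F z ∈ M := by
    intro z hz φ hφ
    refine (hM _).mpr fun s hs => ?_
    have h1 : φ ∘ₗ LinearMap.mulLeft F s ∈ M :=
      (hM _).mpr fun t ht => hMint φ hφ _ ((hS s hs).mul (hS t ht))
    obtain ⟨r, hr⟩ := (hN z).mp hz _ h1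
    exact ⟨r, by simpa [mul_comm] using hr⟩
  have hmulN : ∀ z ∈ N, ∀ y ∈ N, z • y ∈ N := fun z hz y hy =>
    (hN _).mpr fun φ hφ => (hN y).mp hy _ (hmulM z hz φ hφ)
  have hNeq : N = Subalgebra.toSubmodule (integralClosure 𝓡 L) := by
    refine le_antisymm (fun z hz => ?_) hNint
    refine isIntegral_of_smul_mem_submodule N ?_ hNfg z (hmulN z hz)
    exact (Submodule.ne_bot_iff _).mpr ⟨1, hNint 1 isIntegral_one, one_ne_zero⟩
  exact hNeq ▸ hNfg

end Galois

end ReflexiveHull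

/-- For a Prüfer domain `D ⊇ ℚ` with divisible value groups, polynomial rings over `D` satisfy
the condition N-2, provided they are integrally closed. -/
theorem IsDivisiblePrufer.fg_integralClosure {D σ L : Type*} [CommRing D] [IsDomain D]
    [Algebra ℚ D] (hD : IsDivisiblePrufer D) [Finite σ] [IsIntegrallyClosed (MvPolynomial σ D)]
    (F : Type*) [Field F] [Algebra (MvPolynomial σ D) F] [IsFractionRing (MvPolynomial σ D) F]
    [Field L] [Algebra F L] [FiniteDimensional F L] [Algebra (MvPolynomial σ D) L]
    [IsScalarTower (MvPolynomial σ D) F L] :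
    (Subalgebra.toSubmodule (integralClosure (MvPolynomial σ D) L)).FG := by
  have : CharZero D := algebraRat.charZero D
  have : CharZero F := charZero_of_injective_algebraMap
    (IsFractionRing.injective (MvPolynomial σ D) F)
  have : CharZero L := charZero_of_injective_algebraMap (algebraMap F L).injective
  let Ω := IntermediateField.normalClosure F L (AlgebraicClosure L)
  have : FiniteDimensional L Ω := Module.Finite.right F L Ω
  let : Algebra (MvPolynomial σ D) Ω :=
    ((algebraMap L Ω).comp (algebraMap (MvPolynomial σ D) L)).toAlgebra
  have : IsScalarTower (MvPolynomial σ D) L Ω := .of_algebraMap_eq fun _ => rfl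
  have : IsScalarTower (MvPolynomial σ D) F Ω := .of_algebraMap_eq fun r => by
    rw [IsScalarTower.algebraMap_apply (MvPolynomial σ D) L Ω,
      IsScalarTower.algebraMap_apply (MvPolynomial σ D) F L,
      ← IsScalarTower.algebraMap_apply F L Ω]
  exact fg_integralClosure_of_fg_extension (Ω := Ω)
    (fg_integralClosure_of_isGalois (F := F) (L := Ω) hD)

section LinearNormalization

theorem MvPolynomial.coeff_aeval_C_mul_X {V L ι : Type*} [CommRing V] [CommRing L] [Algebra V L]
    (a : ι → L) (f : MvPolynomial ι V) (e : ℕ) :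
    (aeval (fun i => Polynomial.C (a i) * Polynomial.X) f : Polynomial L).coeff e =
      aeval a (homogeneousComponent e f) := by
  induction f using MvPolynomial.induction_on' with
  | add p q hp hq => simp [hp, hq]
  | monomial ν v =>
    have h1 : (aeval (fun i => Polynomial.C (a i) * Polynomial.X) (monomial ν v) : Polynomial L) =
        Polynomial.C (aeval a (monomial ν v)) * Polynomial.X ^ ν.degree := by
      simp only [aeval_monomial, mul_pow, Finsupp.prod, Finset.prod_mul_distrib,
        Finset.prod_pow_eq_pow_sum, map_mul, map_prod, map_pow, Finsupp.degree,
        Polynomial.algebraMap_apply]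
      rw [mul_assoc]
      rfl
    rw [h1, Polynomial.coeff_C_mul_X_pow]
    by_cases h : e = ν.degree
    · rw [if_pos h, homogeneousComponent_of_mem (isHomogeneous_monomial v h.symm), if_pos rfl]
    · rw [if_neg h, homogeneousComponent_of_mem (isHomogeneous_monomial v rfl), if_neg h, map_zero]

theorem MvPolynomial.natDegree_and_coeff_aeval_C_add {V S ι : Type*} [CommRing V]
    [CommRing S] [Algebra V S] (p c : ι → S) {f : MvPolynomial ι V} {e : ℕ}
    (hf : f.IsHomogeneous e) :
    (aeval (fun i => Polynomial.C (p i) + Polynomial.C (c i) * Polynomial.X) f :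
      Polynomial S).natDegree ≤ e ∧
    (aeval (fun i => Polynomial.C (p i) + Polynomial.C (c i) * Polynomial.X) f :
      Polynomial S).coeff e = aeval c f := by
  have hmon : ∀ ν : ι →₀ ℕ, ∀ s : Finset ι,
      (∏ i ∈ s, (Polynomial.C (p i) + Polynomial.C (c i) * Polynomial.X) ^ ν i).natDegree ≤
        ∑ i ∈ s, ν i ∧
      (∏ i ∈ s, (Polynomial.C (p i) + Polynomial.C (c i) * Polynomial.X) ^ ν i).coeff
        (∑ i ∈ s, ν i) = ∏ i ∈ s, c i ^ ν i := by
    classical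
    intro ν s
    induction s using Finset.induction_on with
    | empty => simp
    | insert i s hi ih =>
      have hlin : (Polynomial.C (p i) + Polynomial.C (c i) * Polynomial.X).natDegree ≤ 1 := by
        compute_degree
      have hpow := Polynomial.natDegree_pow_le_of_le (ν i) hlin
      rw [mul_one] at hpow
      rw [Finset.prod_insert hi, Finset.sum_insert hi, Finset.prod_insert hi]
      refine ⟨Polynomial.natDegree_mul_le_of_le hpow ih.1, ?_⟩
      rw [Polynomial.coeff_mul_add_eq_of_natDegree_le hpow ih.1, ih.2]
      have := Polynomial.coeff_pow_of_natDegree_le (m := ν i) hlin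
      rw [mul_one] at this
      rw [this]
      simp
  rw [f.as_sum]
  simp only [map_sum, Polynomial.finsetSum_coeff, aeval_monomial, Polynomial.algebraMap_apply,
    Polynomial.coeff_C_mul]
  constructor
  · refine Polynomial.natDegree_sum_le_of_forall_le _ _ fun ν hν => ?_
    refine (Polynomial.natDegree_C_mul_le _ _).trans ?_
    rw [← hf (mem_support_iff.mp hν)]
    have := (hmon ν ν.support).1
    simpa [Finsupp.weight_apply, Finsupp.sum, Finsupp.prod] using this
  · refine Finset.sum_congr rfl fun ν hν => ?_
    congr 1
    rw [← hf (mem_support_iff.mp hν)]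
    have := (hmon ν ν.support).2
    simpa [Finsupp.weight_apply, Finsupp.sum, Finsupp.prod] using this

theorem isIntegral_of_mem_subalgebra {V B : Type*} [CommRing V] [CommRing B] [Algebra V B]
    {S T : Subalgebra V B} (hT : ∀ x ∈ T, IsIntegral S x) {x : B} (hx : IsIntegral T x) :
    IsIntegral S x := by
  let Q := integralClosure S B
  let j : T →+* Q := T.val.toRingHom.codRestrict Q.toSubring fun x => hT x x.2
  have : IsIntegral Q x := by
    obtain ⟨p, hp, h⟩ := hx
    refine ⟨p.map j, hp.map j, ?_⟩
    rw [Polynomial.eval₂_map]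
    exact h
  exact isIntegral_trans x this

theorem exists_homogeneous_relation {V L : Type*} [CommRing V] [IsDomain V] [IsLocalRing V]
    (hV : (IsLocalRing.maximalIdeal V).LocallyTotal) [Field L] [Algebra V L] [FaithfulSMul V L]
    {ι : Type*} {a : ι → L}
    (ha : ¬ AlgebraicIndependent V fun i => Polynomial.C (a i) * Polynomial.X) :
    ∃ (e : ℕ) (f : MvPolynomial ι V), f.IsHomogeneous e ∧
      f ∉ (IsLocalRing.maximalIdeal V).map MvPolynomial.C ∧ MvPolynomial.aeval a f = 0 := by
  rw [AlgebraicIndependent, injective_iff_map_eq_zero] at ha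
  push Not at ha
  obtain ⟨F, hF, hF0⟩ := ha
  obtain ⟨e, he⟩ : ∃ e, MvPolynomial.homogeneousComponent e F ≠ 0 := by
    by_contra! h
    apply hF0
    rw [← F.sum_homogeneousComponent]
    exact Finset.sum_eq_zero fun e _ => h e
  obtain ⟨s, hs, c, hc, f, hf, h⟩ := MvPolynomial.exists_C_mul_eq_C_mul hV he
  have hs' : s ≠ 0 := fun h => hs (h ▸ Ideal.zero_mem _)
  refine ⟨e, f, fun ν hν => ?_, hf, ?_⟩
  · apply MvPolynomial.homogeneousComponent_isHomogeneous e F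
    intro h0
    have := congrArg (MvPolynomial.coeff ν) h
    rw [MvPolynomial.coeff_C_mul, MvPolynomial.coeff_C_mul, h0, mul_zero] at this
    exact mul_ne_zero hc hν this.symm
  · have h1 := congrArg (MvPolynomial.aeval a) h
    rw [map_mul, map_mul, ← MvPolynomial.coeff_aeval_C_mul_X, hF, Polynomial.coeff_zero,
      mul_zero, MvPolynomial.aeval_C] at h1
    refine (mul_eq_zero.mp h1.symm).resolve_left ?_
    rwa [← ne_eq, map_ne_zero_iff _ (FaithfulSMul.algebraMap_injective V L)]

theorem exists_isUnit_eval {V : Type*} [CommRing V] [IsLocalRing V]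
    [Infinite (IsLocalRing.ResidueField V)] {ι : Type*} (i : ι) {f : MvPolynomial ι V}
    (hf : f ∉ (IsLocalRing.maximalIdeal V).map MvPolynomial.C) :
    ∃ c : ι → V, IsUnit (MvPolynomial.eval c f) ∧ IsUnit (c i) := by
  have hf' : MvPolynomial.map (IsLocalRing.residue V) f ≠ 0 := by
    intro h
    have := MvPolynomial.ker_map (σ := ι) (IsLocalRing.residue V)
    rw [IsLocalRing.ker_residue] at this
    exact hf (this ▸ h)
  have hg : MvPolynomial.map (IsLocalRing.residue V) (f * MvPolynomial.X i) ≠ 0 := by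
    rw [map_mul, MvPolynomial.map_X]
    exact mul_ne_zero hf' (MvPolynomial.X_ne_zero i)
  obtain ⟨x, hx⟩ : ∃ x, MvPolynomial.eval x
      (MvPolynomial.map (IsLocalRing.residue V) (f * MvPolynomial.X i)) ≠ 0 := by
    by_contra! h
    exact hg (MvPolynomial.funext fun x => by rw [h x, map_zero])
  choose c hc using fun j => IsLocalRing.residue_surjective (x j)
  obtain rfl : (fun j => IsLocalRing.residue V (c j)) = x := funext hc
  have h2 : IsLocalRing.residue V (MvPolynomial.eval c (f * MvPolynomial.X i)) ≠ 0 := by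
    rw [MvPolynomial.eval_map] at hx
    convert hx using 1
    exact MvPolynomial.eval₂_comp_left (IsLocalRing.residue V) (RingHom.id V) c _
  rw [IsLocalRing.residue_ne_zero_iff_isUnit, map_mul, MvPolynomial.eval_X,
    IsUnit.mul_iff] at h2
  exact ⟨c, h2⟩

theorem exists_linear_normalization {V L : Type*} [CommRing V] [IsDomain V] [IsLocalRing V]
    [Infinite (IsLocalRing.ResidueField V)] (hV : (IsLocalRing.maximalIdeal V).LocallyTotal)
    [Field L] [Algebra V L] [FaithfulSMul V L] {n : ℕ} (a : Fin n → L) :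
    ∃ (d : ℕ) (b : Fin d → L), (∀ j, b j ∈ Submodule.span V (Set.range a)) ∧
      AlgebraicIndependent V (fun j => Polynomial.C (b j) * Polynomial.X) ∧
      ∀ i, IsIntegral (Algebra.adjoin V (Set.range fun j => Polynomial.C (b j) * Polynomial.X))
        (Polynomial.C (a i) * Polynomial.X) := by
  induction n with
  | zero =>
    refine ⟨0, a, fun j => j.elim0, ?_, fun i => i.elim0⟩
    rw [algebraicIndependent_empty_type_iff]
    exact FaithfulSMul.algebraMap_injective V (Polynomial L)
  | succ n ih =>
    by_cases ha : AlgebraicIndependent V fun i => Polynomial.C (a i) * Polynomial.X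
    · refine ⟨n + 1, a, fun j => Submodule.subset_span ⟨j, rfl⟩, ha, fun i => ?_⟩
      let S := Algebra.adjoin V (Set.range fun i => Polynomial.C (a i) * Polynomial.X)
      exact isIntegral_algebraMap (R := S) (x := ⟨_, Algebra.subset_adjoin ⟨i, rfl⟩⟩)
    obtain ⟨e, f, hfe, hf, hfa⟩ := exists_homogeneous_relation hV ha
    obtain ⟨c, hcf, hc⟩ := exists_isUnit_eval (Fin.last n) hf
    obtain ⟨u, hu⟩ := hc.exists_left_inv
    let t : L := u • a (Fin.last n)
    let b' : Fin (n + 1) → L := fun i => a i - c i • t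
    have hb'last : b' (Fin.last n) = 0 := by
      simp only [b', t, smul_smul]
      rw [mul_comm, hu, one_smul, sub_self]
    obtain ⟨d, b, hb, hind, hint⟩ := ih fun i => b' i.castSucc
    set S := Algebra.adjoin V (Set.range fun j => Polynomial.C (b j) * Polynomial.X)
    have hb'mem : ∀ i, b' i ∈ Submodule.span V (Set.range a) := fun i =>
      sub_mem (Submodule.subset_span ⟨i, rfl⟩)
        (Submodule.smul_mem _ _ (Submodule.smul_mem _ _ (Submodule.subset_span ⟨_, rfl⟩)))
    have hint' : ∀ i, IsIntegral S (Polynomial.C (b' i) * Polynomial.X) := by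
      intro i
      induction i using Fin.lastCases with
      | last => rw [hb'last, map_zero, zero_mul]; exact isIntegral_zero
      | cast i => exact hint i
    let T := Algebra.adjoin V (Set.range fun i => Polynomial.C (b' i) * Polynomial.X)
    have hT : ∀ x ∈ T, IsIntegral S x := by
      have : T ≤ (integralClosure S (Polynomial L)).restrictScalars V :=
        Algebra.adjoin_le (by rintro _ ⟨i, rfl⟩; exact hint' i)
      exact this
    have htint : IsIntegral S (Polynomial.C t * Polynomial.X) := by
      refine isIntegral_of_mem_subalgebra hT ?_
      let z' : Fin (n + 1) → T := fun i => ⟨_, Algebra.subset_adjoin ⟨i, rfl⟩⟩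
      let P : Polynomial T := MvPolynomial.aeval
        (fun i => Polynomial.C (z' i) + Polynomial.C (algebraMap V T (c i)) * Polynomial.X) f
      obtain ⟨hP1, hP2⟩ := MvPolynomial.natDegree_and_coeff_aeval_C_add z'
        (fun i => algebraMap V T (c i)) hfe
      have hPc : P.coeff e = algebraMap V T (MvPolynomial.eval c f) := by
        rw [hP2]
        exact MvPolynomial.aeval_algebraMap_apply T c f
      have hPeval : Polynomial.aeval (Polynomial.C t * Polynomial.X : Polynomial L) P = 0 := by
        have h1 : Polynomial.aeval (Polynomial.C t * Polynomial.X : Polynomial L) P =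
            (MvPolynomial.aeval fun i => Polynomial.C (a i) * Polynomial.X :
              MvPolynomial (Fin (n + 1)) V →ₐ[V] Polynomial L) f := by
          change ((Polynomial.aeval (Polynomial.C t * Polynomial.X : Polynomial L)).restrictScalars
            V) (MvPolynomial.aeval _ f) = _
          rw [MvPolynomial.comp_aeval_apply]
          congr 2
          ext1 i
          simp only [AlgHom.restrictScalars_apply, map_add, map_mul, Polynomial.aeval_C,
            Polynomial.aeval_X]
          change Polynomial.C (a i - c i • t) * Polynomial.X +
            algebraMap V (Polynomial L) (c i) * _ = _
          rw [← Algebra.smul_def, Polynomial.C_sub, ← Polynomial.smul_C, sub_mul, smul_mul_assoc,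
            sub_add_cancel]
        rw [h1]
        ext k
        rw [MvPolynomial.coeff_aeval_C_mul_X, MvPolynomial.homogeneousComponent_of_mem hfe]
        split_ifs <;> simp [hfa]
      obtain ⟨v, hv⟩ := hcf.exists_left_inv
      have hmonic : (Polynomial.C (algebraMap V T v) * P).Monic := by
        refine Polynomial.monic_of_natDegree_le_of_coeff_eq_one e
          ((Polynomial.natDegree_C_mul_le _ _).trans hP1) ?_
        rw [Polynomial.coeff_C_mul, hPc, ← map_mul, hv, map_one]
      refine ⟨_, hmonic, ?_⟩
      rw [← Polynomial.aeval_def, map_mul, hPeval, mul_zero]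
    refine ⟨d, b, fun j => ?_, hind, fun i => ?_⟩
    · refine (Submodule.span_le.mpr ?_) (hb j)
      rintro _ ⟨i, rfl⟩
      exact hb'mem _
    · have : Polynomial.C (a i) * Polynomial.X = Polynomial.C (b' i) * Polynomial.X +
          c i • (Polynomial.C t * Polynomial.X) := by
        rw [Polynomial.C_sub, ← Polynomial.smul_C, sub_mul, smul_mul_assoc, sub_add_cancel]
      rw [this]
      exact (hint' i).add (htint.smul (c i))

end LinearNormalization

section Descent

open Polynomial

theorem isIntegral_mul_of_forall_coeff_mem {A B S : Type*} [CommRing A] [CommRing B]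
    [Algebra A B] [SetLike S B] [SubringClass S B] (T : S) {p : A[X]} (hp : p.Monic) {s x : B}
    (hx : aeval x p = 0)
    (h : ∀ k < p.natDegree, algebraMap A B (p.coeff k) * s ^ (p.natDegree - k) ∈ T) :
    IsIntegral T (s * x) := by
  nontriviality B
  have hdeg : (p.map (algebraMap A B)).natDegree = p.natDegree := hp.natDegree_map _
  let q := (p.map (algebraMap A B)).scaleRoots s
  have hq : q.Monic := (monic_scaleRoots_iff _).mpr (hp.map _)
  have hq0 : q.eval (s * x) = 0 := by
    refine scaleRoots_eval₂_eq_zero (RingHom.id B) (?_ : eval x _ = 0)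
    rw [eval_map, ← aeval_def, hx]
  have hlift : q ∈ lifts (algebraMap T B) := by
    rw [lifts_iff_coeff_lifts]
    intro k
    suffices q.coeff k ∈ T from ⟨⟨_, this⟩, rfl⟩
    rw [coeff_scaleRoots, coeff_map, hdeg]
    rcases lt_trichotomy k p.natDegree with hk | hk | hk
    · exact h k hk
    · rw [hk, hp.coeff_natDegree, Nat.sub_self, pow_zero, map_one, mul_one]
      exact one_mem _
    · rw [coeff_eq_zero_of_natDegree_lt hk, map_zero, zero_mul]
      exact zero_mem _
  obtain ⟨r, hr, -, hrm⟩ := lifts_and_natDegree_eq_and_monic hlift hq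
  exact ⟨r, hrm, by rw [← eval_map, hr, hq0]⟩

theorem IsLocalization.exists_isIntegral_adjoin_smul {D V B : Type*} [CommRing D] [CommRing V]
    [CommRing B] [Algebra D V] [Algebra D B] [Algebra V B] [IsScalarTower D V B]
    (M : Submonoid D) [IsLocalization M V] (w : Set B) {x : B}
    (hx : IsIntegral (Algebra.adjoin V w) x) :
    ∃ δ ∈ M, IsIntegral (Algebra.adjoin D w) (δ • x) := by
  obtain ⟨p, hp, hpx⟩ := hx
  have hcoeff : ∀ y ∈ Algebra.adjoin V w, ∃ δ ∈ M, δ • y ∈ Algebra.adjoin D w := by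
    intro y hy
    rw [← Subalgebra.mem_toSubmodule, Algebra.adjoin_eq_span] at hy
    obtain ⟨⟨δ, hδ⟩, h⟩ := multiple_mem_span_of_mem_localization_span M V _ _ hy
    refine ⟨δ, hδ, ?_⟩
    rwa [← Subalgebra.mem_toSubmodule, Algebra.adjoin_eq_span]
  choose δ hδM hδ using fun k => hcoeff _ (p.coeff k).2
  let d := ∏ k ∈ Finset.range p.natDegree, δ k
  refine ⟨d, Submonoid.prod_mem _ fun k _ => hδM k, ?_⟩
  rw [Algebra.smul_def]
  refine isIntegral_mul_of_forall_coeff_mem (Algebra.adjoin D w) hp hpx fun k hk => ?_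
  obtain ⟨c, hc⟩ : δ k ∣ d ^ (p.natDegree - k) :=
    (Finset.dvd_prod_of_mem δ (Finset.mem_range.mpr hk)).trans (dvd_pow_self _ (by omega))
  rw [← map_pow, mul_comm, ← Algebra.smul_def, hc, mul_comm, mul_smul]
  exact Subalgebra.smul_mem _ (hδ k) c

theorem exists_linear_normalization_at {D L : Type*} [CommRing D] [IsDomain D] [Algebra ℚ D]
    {m : Ideal D} [m.IsPrime] (hm : m.LocallyTotal) [Field L] [Algebra D L] [FaithfulSMul D L]
    {n : ℕ} (a : Fin n → L) :
    ∃ (d : ℕ) (b : Fin d → L), (∀ j, b j ∈ Submodule.span D (Set.range a)) ∧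
      AlgebraicIndependent D (fun j => C (b j) * X) ∧
      ∃ δ ∉ m, ∀ i, IsIntegral (Algebra.adjoin D (Set.range fun j => C (b j) * X))
        (δ • (C (a i) * X)) := by
  let V := Localization.AtPrime m
  have : ValuationRing V := hm.valuationRing_localization
  have hunit : ∀ s : m.primeCompl, IsUnit (algebraMap D L s) := fun s => by
    rw [isUnit_iff_ne_zero, map_ne_zero_iff _ (FaithfulSMul.algebraMap_injective D L)]
    exact fun h => s.2 (h ▸ m.zero_mem)
  let : Algebra V L := (IsLocalization.lift hunit).toAlgebra
  have hDV : Function.Injective (algebraMap D V) :=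
    IsLocalization.injective V m.primeCompl_le_nonZeroDivisors
  have : IsScalarTower D V L := .of_algebraMap_eq fun x => (IsLocalization.lift_eq hunit x).symm
  have : FaithfulSMul V L := by
    rw [faithfulSMul_iff_algebraMap_injective]
    refine (IsLocalization.lift_injective_iff hunit).mpr fun x y => ?_
    rw [hDV.eq_iff, (FaithfulSMul.algebraMap_injective D L).eq_iff]
  have : CharZero (IsLocalRing.ResidueField V) := algebraRat.charZero _
  have hV : (IsLocalRing.maximalIdeal V).LocallyTotal := by
    intro x y
    have h1 := (Ideal.ne_top_iff_one _).mp (IsLocalRing.maximalIdeal.isMaximal V).ne_top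
    obtain ⟨c, h | h⟩ := ValuationRing.cond x y
    · exact ⟨1, h1, c, Or.inr (by rw [← h]; ring)⟩
    · exact ⟨1, h1, c, Or.inl (by rw [← h]; ring)⟩
  obtain ⟨d, b, hb, hind, hint⟩ := exists_linear_normalization hV a
  choose s hs using fun j => multiple_mem_span_of_mem_localization_span m.primeCompl V _ _ (hb j)
  let t : m.primeCompl := ∏ j, s j
  have ht0 : algebraMap D L t ≠ 0 := (hunit t).ne_zero
  let τ : L[X] →ₐ[D] L[X] := (aeval (C (algebraMap D L t) * X)).restrictScalars D
  have hτ : Function.Injective τ := by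
    rw [injective_iff_map_eq_zero]
    intro p hp
    exact (comp_C_mul_X_eq_zero_iff (mem_nonZeroDivisors_of_ne_zero ht0)).mp hp
  have hτb : (fun j => C ((t : D) • b j) * X) = τ ∘ fun j => C (b j) * X := by
    ext1 j
    simp only [Function.comp_apply, τ, AlgHom.restrictScalars_apply, map_mul, aeval_C, aeval_X,
      Algebra.smul_def, algebraMap_eq]
    ring
  have key : ∀ i, ∃ δ ∈ m.primeCompl, IsIntegral (Algebra.adjoin D
      (Set.range fun j => C ((t : D) • b j) * X)) (δ • (C (a i) * X)) := by
    intro i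
    apply IsLocalization.exists_isIntegral_adjoin_smul (V := V)
    refine isIntegral_of_mem_subalgebra (fun x hx => ?_) (hint i)
    let S := Algebra.adjoin V (Set.range fun j => C ((t : D) • b j) * X)
    suffices Algebra.adjoin V (Set.range fun j => C (b j) * X) ≤ S from
      isIntegral_algebraMap (x := (⟨x, this hx⟩ : S))
    refine Algebra.adjoin_le ?_
    rintro _ ⟨j, rfl⟩
    obtain ⟨v, hv⟩ := (IsLocalization.map_units V t).exists_left_inv
    have h1 : C (b j) * X = v • (C ((t : D) • b j) * X) := by
      rw [← algebraMap_smul V (t : D) (b j), ← smul_mul_assoc, smul_C, smul_smul, hv, one_smul]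
    change C (b j) * X ∈ _
    rw [h1]
    exact Subalgebra.smul_mem _ (Algebra.subset_adjoin (Set.mem_range_self j)) v
  choose δ hδ hδi using key
  refine ⟨d, fun j => (t : D) • b j, fun j => ?_, ?_, ∏ i, δ i, ?_, fun i => ?_⟩
  · obtain ⟨c, hc⟩ : s j ∣ t := Finset.dvd_prod_of_mem s (Finset.mem_univ j)
    change (t : D) • b j ∈ _
    rw [hc, mul_comm, Submonoid.coe_mul, mul_smul]
    exact Submodule.smul_mem _ _ (hs j)
  · rw [hτb]
    exact (hind.restrictScalars hDV).map' hτ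
  · exact Submonoid.prod_mem m.primeCompl fun i _ => hδ i
  · obtain ⟨c, hc⟩ := Finset.dvd_prod_of_mem δ (Finset.mem_univ i)
    rw [hc, mul_comm, mul_smul]
    exact (hδi i).smul c

end Descent

theorem fg_integralClosure_of_adjoin_eq_top {P B F L : Type*} [CommRing P] [CommRing B]
    [IsDomain B] [IsIntegrallyClosed B] [Algebra P B]
    [Field F] [Algebra P F] [Field L] [Algebra B L] [IsFractionRing B L] [Algebra P L]
    [IsScalarTower P B L] [Algebra F L] [IsScalarTower P F L]
    (hP : FiniteDimensional F L → (Subalgebra.toSubmodule (integralClosure P L)).FG)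
    {ι : Type*} [Finite ι] (z : ι → B) (hz : ∀ i, IsIntegral P (z i))
    (htop : ∀ K : Subfield L,
      (∀ p, algebraMap P L p ∈ K) → (∀ i, algebraMap B L (z i) ∈ K) → K = ⊤) :
    (Subalgebra.toSubmodule (integralClosure P B)).FG := by
  have hinj : Function.Injective (algebraMap B L) := IsFractionRing.injective _ _
  let E := IntermediateField.adjoin F (Set.range fun i => algebraMap B L (z i))
  have hE : FiniteDimensional F E := by
    refine IntermediateField.finiteDimensional_adjoin ?_
    rintro _ ⟨i, rfl⟩
    exact ((hz i).map (IsScalarTower.toAlgHom P B L)).tower_top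
  have hE' : E = ⊤ := by
    rw [← IntermediateField.toSubfield_inj]
    refine htop _ (fun p => ?_) fun i => IntermediateField.subset_adjoin _ _ ⟨i, rfl⟩
    rw [IsScalarTower.algebraMap_apply P F L]
    exact E.algebraMap_mem _
  have : FiniteDimensional F L := by
    rw [hE'] at hE
    exact Module.Finite.equiv IntermediateField.topEquiv.toLinearEquiv
  refine Submodule.fg_of_fg_map_injective (IsScalarTower.toAlgHom P B L).toLinearMap hinj ?_
  convert hP this
  ext x
  constructor
  · rintro ⟨y, hy, rfl⟩
    exact IsIntegral.map (IsScalarTower.toAlgHom P B L) hy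
  · intro hx
    have hx' : IsIntegral P x := hx
    obtain ⟨y, rfl⟩ := IsIntegrallyClosed.isIntegral_iff.mp (hx'.tower_top (A := B))
    exact ⟨y, (isIntegral_algebraMap_iff hinj).mp hx', rfl⟩

theorem exists_isIntegral_pow_mul {D P A B : Type*} [CommRing D] [CommRing P] [CommRing A]
    [CommRing B] [Algebra D P] [Algebra D A] [Algebra D B] [Algebra P B] [Algebra A B]
    [IsScalarTower D P B] [IsScalarTower D A B] {s : B} (hs : IsIntegral P s) {S : Set A}
    (hS : Algebra.adjoin D S = ⊤) (h : ∀ y ∈ S, ∃ k : ℕ, IsIntegral P (s ^ k * algebraMap A B y))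
    {x : B} (hx : IsIntegral A x) : ∃ k : ℕ, IsIntegral P (s ^ k * x) := by
  have hA (c : A) : ∃ k, ∀ l ≥ k, IsIntegral P (s ^ l * algebraMap A B c) := by
    have mono {k : ℕ} {c : A} (h : IsIntegral P (s ^ k * algebraMap A B c)) :
        ∀ l ≥ k, IsIntegral P (s ^ l * algebraMap A B c) := fun l hl => by
      rw [← Nat.sub_add_cancel hl, pow_add, mul_assoc]
      exact (hs.pow _).mul h
    have hc : c ∈ Algebra.adjoin D S := hS ▸ Algebra.mem_top
    induction hc using Algebra.adjoin_induction with
    | mem y hy => exact (h y hy).imp fun _ => mono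
    | algebraMap r =>
      refine ⟨0, mono ?_⟩
      rw [pow_zero, one_mul, ← IsScalarTower.algebraMap_apply,
        IsScalarTower.algebraMap_apply D P B]
      exact isIntegral_algebraMap
    | add u v _ _ hu hv =>
      obtain ⟨k, hk⟩ := hu
      obtain ⟨l, hl⟩ := hv
      refine ⟨max k l, mono ?_⟩
      rw [map_add, mul_add]
      exact (hk _ (le_max_left _ _)).add (hl _ (le_max_right _ _))
    | mul u v _ _ hu hv =>
      obtain ⟨k, hk⟩ := hu
      obtain ⟨l, hl⟩ := hv
      refine ⟨k + l, mono ?_⟩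
      rw [map_mul, pow_add, mul_mul_mul_comm]
      exact (hk _ le_rfl).mul (hl _ le_rfl)
  choose e he using hA
  obtain ⟨p, hp, hpx⟩ := hx
  let k := (Finset.range p.natDegree).sup fun i => e (p.coeff i)
  refine ⟨k, isIntegral_trans (A := integralClosure P B) _
    (isIntegral_mul_of_forall_coeff_mem _ hp hpx fun i hi => ?_)⟩
  rw [← pow_mul, mul_comm]
  refine he _ _ (le_trans ?_ (Nat.le_mul_of_pos_right k (Nat.sub_pos_of_lt hi)))
  exact Finset.le_sup (f := fun i => e (p.coeff i)) (Finset.mem_range.mpr hi)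

section Domain

open Polynomial

theorem Subfield.eq_top_of_forall_C_mem {A K L : Type*} [CommRing A] [Field K] [Algebra A K]
    [IsFractionRing A K] [Field L] [Algebra K[X] L] [IsFractionRing K[X] L] {S : Subfield L}
    (hS : ∀ a : A, algebraMap K[X] L (C (algebraMap A K a)) ∈ S)
    (hX : algebraMap K[X] L X ∈ S) : S = ⊤ := by
  have hC (c : K) : algebraMap K[X] L (C c) ∈ S := by
    obtain ⟨u, v, -, rfl⟩ := IsFractionRing.div_surjective (A := A) c
    have := S.div_mem (hS u) (hS v)
    exact (map_div₀ ((algebraMap K[X] L).comp C) (algebraMap A K u) (algebraMap A K v)) ▸ this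
  have hp (p : K[X]) : algebraMap K[X] L p ∈ S := by
    induction p using Polynomial.induction_on' with
    | add p q hp hq => simpa only [map_add] using S.add_mem hp hq
    | monomial n c =>
      rw [← C_mul_X_pow_eq_monomial, map_mul, map_pow]
      exact S.mul_mem (hC c) (S.pow_mem hX n)
  refine _root_.eq_top_iff.mpr fun x _ => ?_
  obtain ⟨p, q, -, rfl⟩ := IsFractionRing.div_surjective (A := K[X]) x
  exact S.div_mem (hp p) (hp q)

namespace IsDivisiblePrufer

variable {D A L : Type*} [CommRing D] [IsDomain D] [Algebra ℚ D]
  [CommRing A] [Algebra D A] [Field L] [Algebra A L] [IsFractionRing A L]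

theorem fg_integralClosure_polynomial (hD : IsDivisiblePrufer D) [Algebra D L]
    [IsScalarTower D A L] {d : ℕ} [Algebra (MvPolynomial (Fin d) D) L[X]]
    [IsScalarTower D (MvPolynomial (Fin d) D) L[X]] [FaithfulSMul (MvPolynomial (Fin d) D) L[X]]
    {n : ℕ} {a : Fin n → A} (ha : Algebra.adjoin D (Set.range a) = ⊤) {i₀ : Fin n}
    (hi₀ : a i₀ = 1) {δ : D} (hδ : δ ≠ 0)
    (hint : ∀ i, IsIntegral (MvPolynomial (Fin d) D) (δ • (C (algebraMap A L (a i)) * X))) :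
    (Subalgebra.toSubmodule (integralClosure (MvPolynomial (Fin d) D) L[X])).FG := by
  let P := MvPolynomial (Fin d) D
  let L₂ := FractionRing L[X]
  have hL₂ : Function.Injective (algebraMap L[X] L₂) := IsFractionRing.injective _ _
  have hPL : Function.Injective (algebraMap P L₂) := by
    rw [IsScalarTower.algebraMap_eq P L[X] L₂]
    exact hL₂.comp (FaithfulSMul.algebraMap_injective P L[X])
  have : FaithfulSMul P L₂ := (faithfulSMul_iff_algebraMap_injective _ _).mpr hPL
  let := FractionRing.liftAlgebra P L₂
  have : IsScalarTower P (FractionRing P) L₂ := FractionRing.isScalarTower_liftAlgebra P L₂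
  have := hD.isIntegrallyClosed
  refine fg_integralClosure_of_adjoin_eq_top (F := FractionRing P) (L := L₂)
    (fun _ => hD.fg_integralClosure (FractionRing P)) _ hint fun K hK hK' => ?_
  have hDP (r : D) : algebraMap L[X] L₂ (algebraMap D L[X] r) = algebraMap P L₂ (.C r) := by
    rw [IsScalarTower.algebraMap_apply P L[X] L₂, IsScalarTower.algebraMap_apply D P L[X]]
    rfl
  have hDK (r : D) : algebraMap L[X] L₂ (algebraMap D L[X] r) ∈ K := hDP r ▸ hK _
  have hδ0 : algebraMap L[X] L₂ (algebraMap D L[X] δ) ≠ 0 := by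
    rw [hDP, ne_eq, map_eq_zero_iff _ hPL]
    exact (map_ne_zero_iff _ (MvPolynomial.C_injective (Fin d) D)).mpr hδ
  have hmem (i : Fin n) : algebraMap L[X] L₂ (C (algebraMap A L (a i)) * X) ∈ K := by
    have := K.mul_mem (K.inv_mem (hDK δ)) (hK' i)
    rwa [Algebra.smul_def, map_mul, inv_mul_cancel_left₀ hδ0] at this
  have hXK : algebraMap L[X] L₂ X ∈ K := by
    simpa only [hi₀, map_one, C_1, one_mul] using hmem i₀
  refine Subfield.eq_top_of_forall_C_mem (A := A) (fun c => ?_) hXK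
  have hc : c ∈ Algebra.adjoin D (Set.range a) := ha ▸ Algebra.mem_top
  induction hc using Algebra.adjoin_induction with
  | mem y hy =>
    obtain ⟨i, rfl⟩ := hy
    have hX0 : algebraMap L[X] L₂ X ≠ 0 := (map_ne_zero_iff _ hL₂).mpr X_ne_zero
    have := K.div_mem (hmem i) hXK
    rwa [map_mul, mul_div_cancel_right₀ _ hX0] at this
  | algebraMap r =>
    have := hDK r
    rwa [Polynomial.algebraMap_apply, IsScalarTower.algebraMap_apply D A L] at this
  | add u v _ _ hu hv => simpa only [map_add] using K.add_mem hu hv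
  | mul u v _ _ hu hv => simpa only [map_mul] using K.mul_mem hu hv

theorem exists_fg_le_integralClosure [FaithfulSMul D A] (hD : IsDivisiblePrufer D)
    [Algebra D L] [IsScalarTower D A L] {n : ℕ} {a : Fin n → A}
    (ha : Algebra.adjoin D (Set.range a) = ⊤) {i₀ : Fin n} (hi₀ : a i₀ = 1) (m : Ideal D)
    [hm : m.IsMaximal] : ∃ δ ∉ m, ∃ Y : Submodule A L, Y.FG ∧
      Y ≤ Subalgebra.toSubmodule (integralClosure A L) ∧
      ∀ w ∈ Subalgebra.toSubmodule (integralClosure A L), ∃ k : ℕ,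
        algebraMap D A δ ^ k • w ∈ Y := by
  have hAL : Function.Injective (algebraMap A L) := IsFractionRing.injective _ _
  have : FaithfulSMul D L := by
    rw [faithfulSMul_iff_algebraMap_injective, IsScalarTower.algebraMap_eq D A L]
    exact hAL.comp (FaithfulSMul.algebraMap_injective D A)
  obtain ⟨d, b, hb, hind, δ, hδm, hδ⟩ := exists_linear_normalization_at
    (hD.locallyTotal m hm) (fun i => algebraMap A L (a i))
  have hδ0 : δ ≠ 0 := fun h => hδm (h ▸ m.zero_mem)
  choose b' hb' using fun j => show b j ∈ (IsScalarTower.toAlgHom D A L).range from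
    Submodule.span_le (p := Subalgebra.toSubmodule (IsScalarTower.toAlgHom D A L).range).mpr
      (by rintro _ ⟨i, rfl⟩; exact ⟨a i, rfl⟩) (hb j)
  let P := MvPolynomial (Fin d) D
  let Θ : P →ₐ[D] L[X] := MvPolynomial.aeval fun j => C (b j) * X
  let β : P →ₐ[D] A := MvPolynomial.aeval b'
  let ev : L[X] →ₐ[L] L := Polynomial.aeval 1
  let := Θ.toAlgebra
  have hev : (algebraMap A L).comp (β : P →+* A) = (ev : L[X] →+* L).comp (algebraMap P L[X]) := by
    have : (IsScalarTower.toAlgHom D A L).comp β = (ev.restrictScalars D).comp Θ := by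
      ext j
      simpa [Θ, β, ev] using hb' j
    exact congrArg AlgHom.toRingHom this
  have hev' {x : L[X]} (hx : IsIntegral P x) : IsIntegral A (ev x) :=
    hx.map_of_comp_eq _ (ev : L[X] →+* L) hev
  have : IsScalarTower D P L[X] := .of_algebraMap_eq' Θ.comp_algebraMap.symm
  have hΘ : Function.Injective (algebraMap P L[X]) := hind
  have : FaithfulSMul P L[X] := (faithfulSMul_iff_algebraMap_injective _ _).mpr hΘ
  have hint (i : Fin n) : IsIntegral P (δ • (C (algebraMap A L (a i)) * X)) := by
    let Q := integralClosure P L[X]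
    let S := Algebra.adjoin D (Set.range fun j => C (b j) * X)
    have hS (x : S) : (x : L[X]) ∈ Q := by
      obtain ⟨p, hp⟩ : (x : L[X]) ∈ Θ.range := Algebra.adjoin_range_eq_range_aeval D
        (fun j => C (b j) * X) ▸ x.2
      exact hp ▸ isIntegral_algebraMap (R := P)
    exact isIntegral_trans (A := Q) _ ((hδ i).map_of_comp_eq
      (S.val.toRingHom.codRestrict Q.toSubring hS) (RingHom.id _) rfl)
  have hδX : δ • (C (algebraMap A L (a i₀)) * X) = δ • (X : L[X]) := by
    rw [hi₀, map_one, C_1, one_mul]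
  obtain ⟨G, hG⟩ := fg_integralClosure_polynomial hD ha hi₀ hδ0 hint
  have hGint {x : L[X]} : x ∈ Submodule.span P G ↔ IsIntegral P x := hG ▸ Iff.rfl
  refine ⟨δ, hδm, Submodule.span A (ev '' G), Submodule.fg_span (G.finite_toSet.image _),
    Submodule.span_le.mpr ?_, fun w hw => ?_⟩
  · rintro _ ⟨x, hx, rfl⟩
    exact hev' (hGint.mp (Submodule.subset_span hx))
  obtain ⟨k, hk⟩ := exists_isIntegral_pow_mul (P := P) (B := L[X]) (hδX ▸ hint i₀) ha
    (fun y hy => by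
      obtain ⟨i, rfl⟩ := hy
      refine ⟨1, ?_⟩
      rw [pow_one, smul_mul_assoc, mul_comm, Polynomial.algebraMap_apply]
      exact hint i)
    (IsIntegral.map (IsScalarTower.toAlgHom A L L[X]) hw)
  have hmem {x : L[X]} (hx : x ∈ Submodule.span P (G : Set L[X])) :
      ev x ∈ Submodule.span A (ev '' G) := by
    induction hx using Submodule.span_induction with
    | mem x hx => exact Submodule.subset_span ⟨x, hx, rfl⟩
    | zero => simp
    | add x y _ _ hx hy => simpa only [map_add] using add_mem hx hy
    | smul p x _ hx =>
      have := Submodule.smul_mem _ (β p) hx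
      rw [Algebra.smul_def] at this
      rw [Algebra.smul_def, map_mul]
      exact (RingHom.congr_fun hev p) ▸ this
  refine ⟨k, ?_⟩
  convert hmem (hGint.mpr hk) using 1
  simp [ev, Algebra.smul_def, IsScalarTower.algebraMap_apply D A L]

end IsDivisiblePrufer
end Domain

theorem IsDivisiblePrufer.isN1 {D A : Type u} [CommRing D] [IsDomain D] [Algebra ℚ D]
    (hD : IsDivisiblePrufer D) [CommRing A] [IsDomain A] [Algebra D A] [FaithfulSMul D A]
    [hA : Algebra.FiniteType D A] : IsN1 A := by
  obtain ⟨n, f, hf⟩ := Algebra.FiniteType.iff_quotient_mvPolynomial''.mp hA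
  let a : Fin (n + 1) → A := Fin.cons 1 fun i => f (.X i)
  have ha : Algebra.adjoin D (Set.range a) = ⊤ := by
    refine top_le_iff.mp ?_
    calc ⊤ = Algebra.adjoin D (Set.range fun i => f (.X i)) := by
          rw [Algebra.adjoin_range_eq_range_aeval, eq_comm, ← (AlgHom.range_eq_top f).mpr hf]
          exact congrArg AlgHom.range (MvPolynomial.aeval_unique f).symm
      _ ≤ _ := Algebra.adjoin_mono (by rintro _ ⟨i, rfl⟩; exact ⟨i.succ, rfl⟩)
  exact Module.Finite.of_fg (Submodule.fg_of_forall_isMaximal (D := D)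
    (Subalgebra.toSubmodule (integralClosure A (FractionRing A)))
    fun m _ => hD.exists_fg_le_integralClosure ha (i₀ := 0) rfl m)

theorem Ideal.locallyTotal_of_valuationRing {D : Type*} [CommRing D] [IsDomain D] (m : Ideal D)
    [m.IsPrime] [ValuationRing (Localization.AtPrime m)] : m.LocallyTotal := by
  let V := Localization.AtPrime m
  have key {a b : D} (h : algebraMap D V a ∣ algebraMap D V b) : ∃ s ∉ m, ∃ c, s * b = c * a := by
    obtain ⟨v, hv⟩ := h
    obtain ⟨c, s, rfl⟩ := IsLocalization.exists_mk'_eq m.primeCompl v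
    refine ⟨s, s.2, c, IsLocalization.injective V m.primeCompl_le_nonZeroDivisors ?_⟩
    rw [map_mul, map_mul, hv, mul_left_comm, IsLocalization.mk'_spec', mul_comm]
  intro a b
  obtain h | h := ValuationRing.dvd_total (algebraMap D V b) (algebraMap D V a)
  · obtain ⟨s, hs, c, hc⟩ := key h
    exact ⟨s, hs, c, .inl hc⟩
  · obtain ⟨s, hs, c, hc⟩ := key h
    exact ⟨s, hs, c, .inr hc⟩

theorem HasDivisibleValueGroup.locallyDivisible {D V : Type*} [CommRing D] [IsDomain D]
    {m : Ideal D} [m.IsPrime] [CommRing V] [IsDomain V] [ValuationRing V] [Algebra D V]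
    [IsLocalization.AtPrime V m] (h : HasDivisibleValueGroup V) : m.LocallyDivisible := by
  intro a k hk
  obtain rfl | ha := eq_or_ne a 0
  · have h1 := (m.ne_top_iff_one).mp Ideal.IsPrime.ne_top'
    exact ⟨0, 1, h1, 1, h1, by simp [hk]⟩
  have hDV : Function.Injective (algebraMap D V) :=
    IsLocalization.injective V m.primeCompl_le_nonZeroDivisors
  have hVF : Function.Injective (algebraMap V (FractionRing V)) := IsFractionRing.injective _ _
  have hx : algebraMap V (FractionRing V) (algebraMap D V a) ≠ 0 := by
    rwa [ne_eq, map_eq_zero_iff _ hVF, map_eq_zero_iff _ hDV]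
  obtain ⟨y, u, hu⟩ := h _ hx k (Nat.one_le_iff_ne_zero.mpr hk)
  rw [eq_mul_inv_iff_mul_eq₀ hx, ← map_mul] at hu
  obtain ⟨y, rfl⟩ := IsIntegrallyClosed.exists_algebraMap_eq_of_isIntegral_pow
    (Nat.pos_of_ne_zero hk) (hu ▸ isIntegral_algebraMap : IsIntegral V (y ^ k))
  rw [← map_pow] at hu
  replace hu := hVF hu
  obtain ⟨c, s, rfl⟩ := IsLocalization.exists_mk'_eq m.primeCompl y
  obtain ⟨t, r, hr⟩ := IsLocalization.exists_mk'_eq m.primeCompl (u : V)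
  have ht : t ∉ m := (IsLocalization.AtPrime.isUnit_mk'_iff V m t r).mp (hr ▸ u.isUnit)
  refine ⟨c, r, r.2, t * s ^ k, ?_, hDV ?_⟩
  · exact m.primeCompl.mul_mem ht (pow_mem s.2 k)
  have h1 := IsLocalization.mk'_spec' V c s
  have h2 := IsLocalization.mk'_spec' V t r
  rw [hr] at h2
  simp only [map_mul, map_pow]
  rw [← h1, ← h2, mul_pow, ← hu]
  ring

theorem IsPruferDomain.isDivisiblePrufer {D : Type u} [CommRing D] [IsDomain D]
    (hD : IsPruferDomain D) (hdiv : ∀ (m : Ideal D) [m.IsMaximal],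
      HasDivisibleValueGroup (Localization.AtPrime m)) : IsDivisiblePrufer D where
  locallyTotal m _ := have := hD m; m.locallyTotal_of_valuationRing
  locallyDivisible m _ := have := hD m; (hdiv m).locallyDivisible

/-- A Prüfer domain containing `ℚ` whose localizations at maximal ideals have
divisible value groups is universally Japanese. -/
theorem pruferDomain_ratAlgebra_divisible_universallyJapanese
    (D : Type u) [CommRing D] [IsDomain D] [Algebra ℚ D] (hD : IsPruferDomain D)
    (hdiv : ∀ (𝔪 : Ideal D) [𝔪.IsMaximal],
      HasDivisibleValueGroup (Localization.AtPrime 𝔪)) :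
    UniversallyJapanese D := by
  intro A _ _ _ hA
  let I := RingHom.ker (algebraMap D A)
  have : I.IsPrime := RingHom.ker_isPrime _
  have hDI : IsDivisiblePrufer (D ⧸ I) := (hD.isDivisiblePrufer hdiv).of_surjective
    (Ideal.Quotient.mk I) Ideal.Quotient.mk_surjective
  let := (RingHom.kerLift (algebraMap D A)).toAlgebra
  have : IsScalarTower D (D ⧸ I) A := .of_algebraMap_eq' rfl
  have : FaithfulSMul (D ⧸ I) A := (faithfulSMul_iff_algebraMap_injective _ _).mpr
    (RingHom.kerLift_injective (algebraMap D A))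
  have : Algebra.FiniteType (D ⧸ I) A := .of_restrictScalars_finiteType D (D ⧸ I) A
  exact hDI.isN1
end

section
/- Let R be a Noetherian integral domain that is a ℚ-algebra, has Krull dimension at least 2, and is locally Nagata (the localization of R at every prime ideal is a Nagata ring). Let R⁺ be the integral closure of R in an algebraic closure of its fraction field. Then R⁺ is not universally Japanese. -/
set_option synthInstance.maxHeartbeats 400000
set_option maxHeartbeats 800000

universe u

/-- A Noetherian ring `R` is Nagata if for every prime ideal `𝔭` the domain
`R ⧸ 𝔭` is N-2. -/
def IsNagataRing (R : Type u) [CommRing R] : Prop :=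
  IsNoetherianRing R ∧ ∀ (𝔭 : Ideal R) [𝔭.IsPrime], IsN2 (R ⧸ 𝔭)

open Polynomial

/-- Seidenberg's lemma: if `S` is integrally closed in a field `L` and `t : L` is a root of a
polynomial having a coefficient outside the prime `P`, then `t` or `t⁻¹` lies in the localization
of `S` at `P`. -/
theorem exists_notMem_smul_eq_of_aeval_eq_zero {S L : Type*} [CommRing S] [Field L] [Algebra S L]
    [IsIntegrallyClosedIn S L] (P : Ideal S) (t : L) (f : S[X]) (hf : aeval t f = 0)
    (n : ℕ) (hn : f.coeff n ∉ P) :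
    ∃ a ∉ P, ∃ c : S, a • t = algebraMap S L c ∨ algebraMap S L a = c • t := by
  induction hm : f.natDegree using Nat.strong_induction_on generalizing f n with | h m IH =>
  obtain (_ | m) := m
  · obtain ⟨r, rfl⟩ := natDegree_eq_zero.mp hm
    have hr : r ∉ P := by
      cases n with
      | zero => simpa using hn
      | succ n => simp at hn
    exact ⟨r, hr, 0, Or.inr (by simpa using hf)⟩
  obtain ⟨b, hb⟩ := IsIntegrallyClosedIn.isIntegral_iff.mp (isIntegral_leadingCoeff_smul f t hf)
  by_cases hlc : f.leadingCoeff ∈ P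
  · by_cases hbP : b ∈ P
    · refine IH _ ?_ (f.eraseLead + C b * X ^ m) ?_ n ?_ rfl
      · suffices f.eraseLead.natDegree ≤ m by compute_degree!
        exact (eraseLead_natDegree_le ..).trans (by lia)
      · simp [← self_sub_monomial_natDegree_leadingCoeff, hf, hm, pow_succ', ← Algebra.smul_def,
          ← Algebra.smul_mul_assoc, hb]
      · have hne : n ≠ f.natDegree := by
          rintro rfl
          exact hn hlc
        rw [coeff_add, eraseLead_coeff, if_neg hne, coeff_C_mul_X_pow]
        rwa [Ideal.add_mem_iff_left]
        split_ifs
        · exact hbP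
        · simp
    · exact ⟨b, hbP, f.leadingCoeff, Or.inr hb⟩
  · exact ⟨f.leadingCoeff, hlc, b, Or.inl hb.symm⟩

/-- If an `n`-th root of `t` satisfies a monic equation of degree less than `n` over `S[t]`, then
`t` or `t⁻¹` lies in the localization of `S` at any prime `P`. -/
theorem exists_notMem_smul_eq_of_pow_eq {S L : Type*} [CommRing S] [Field L] [Algebra S L]
    [IsIntegrallyClosedIn S L] (P : Ideal S) [P.IsPrime] (t b : L) (n : ℕ) (hb : b ^ n = t)
    (g : (Algebra.adjoin S {t})[X]) (hg : g.Monic) (hgn : g.natDegree < n)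
    (hgb : aeval b g = 0) :
    ∃ a ∉ P, ∃ c : S, a • t = algebraMap S L c ∨ algebraMap S L a = c • t := by
  have key (i : ℕ) : ∃ G : S[X], aeval t G = (g.coeff i : L) := by
    exact (Algebra.adjoin_singleton_eq_range_aeval S t).le (g.coeff i).2
  choose G hG using key
  let h : S[X] := X ^ g.natDegree + ∑ i ∈ Finset.range g.natDegree, expand S n (G i) * X ^ i
  have h_root : aeval b h = 0 := by
    rw [aeval_eq_sum_range, Finset.sum_range_succ, hg.coeff_natDegree, one_smul] at hgb
    rw [← hgb, add_comm]
    simp only [h, map_add, map_sum, map_mul, map_pow, aeval_X, expand_aeval, hb, hG]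
    rfl
  have h_coeff : h.coeff g.natDegree = 1 := by
    simp only [h, coeff_add, coeff_X_pow_self, finsetSum_coeff, add_eq_left]
    refine Finset.sum_eq_zero fun i hi => ?_
    rw [Finset.mem_range] at hi
    rw [coeff_mul_X_pow', if_pos hi.le, coeff_expand (by lia), if_neg]
    intro hdvd
    exact absurd (Nat.le_of_dvd (by lia) hdvd) (by lia)
  obtain ⟨a, ha, c, hac⟩ := exists_notMem_smul_eq_of_aeval_eq_zero P b h h_root g.natDegree
    (by rw [h_coeff]; exact (Ideal.ne_top_iff_one P).mp Ideal.IsPrime.ne_top')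
  refine ⟨a ^ n, fun h' => ha (Ideal.IsPrime.mem_of_pow_mem ‹_› n h'), c ^ n, ?_⟩
  rcases hac with hac | hac
  · left
    rw [← hb, ← _root_.smul_pow, hac, map_pow]
  · right
    rw [← hb, ← _root_.smul_pow, ← hac, map_pow]

/-- The elements integral over an N-1 domain in its fraction field satisfy monic equations of
bounded degree. -/
theorem IsN1.exists_monic_natDegree_eq {A : Type u} {L : Type*} [CommRing A] [IsDomain A] [Field L]
    [Algebra A L] [IsFractionRing A L] (hA : IsN1 A) :
    ∃ N : ℕ, ∀ b : L, IsIntegral A b → ∃ g : A[X], g.Monic ∧ g.natDegree = N ∧ aeval b g = 0 := by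
  have : Module.Finite A (integralClosure A (FractionRing A)) := hA
  have : Module.Finite A (integralClosure A L) :=
    Module.Finite.equiv (FractionRing.algEquiv A L).mapIntegralClosure.toLinearEquiv
  refine ⟨(⊤ : Submodule A (integralClosure A L)).spanFinrank, fun b hb => ?_⟩
  obtain ⟨g, hg, hgn, hgb⟩ := LinearMap.exists_monic_and_natDegree_eq_and_aeval_eq_zero A
    (Algebra.lmul A (integralClosure A L) ⟨b, hb⟩)
  refine ⟨g, hg, hgn, ?_⟩
  rw [aeval_algHom_apply] at hgb
  have := congrArg (integralClosure A L).val (Algebra.lmul_injective (hgb.trans (map_zero _).symm))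
  rwa [← aeval_algHom_apply, map_zero] at this

/-- Over an integrally closed, universally Japanese domain `S` with algebraically closed fraction
field, every localization at a prime is a valuation ring. -/
theorem UniversallyJapanese.exists_notMem_smul_eq {S L : Type u} [CommRing S] [Field L]
    [IsAlgClosed L] [Algebra S L] [IsFractionRing S L] [IsIntegrallyClosedIn S L]
    (hS : UniversallyJapanese S) (P : Ideal S) [P.IsPrime] (t : L) :
    ∃ a ∉ P, ∃ c : S, a • t = algebraMap S L c ∨ algebraMap S L a = c • t := by
  let A := Algebra.adjoin S {t}
  have : IsFractionRing A L := IsFractionRing.of_field A L fun z => by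
    obtain ⟨x, y, -, rfl⟩ := IsFractionRing.div_surjective S z
    exact ⟨algebraMap S A x, algebraMap S A y, rfl⟩
  have hft : Algebra.FiniteType S A :=
    A.fg_iff_finiteType.mp ⟨{t}, by simp [A]⟩
  obtain ⟨N, hN⟩ := (hS A hft).exists_monic_natDegree_eq (L := L)
  obtain ⟨b, hb⟩ := IsAlgClosed.exists_pow_nat_eq t N.succ_pos
  have hbi : IsIntegral A b := by
    refine IsIntegral.of_pow N.succ_pos ?_
    rw [hb]
    exact isIntegral_algebraMap (x := (⟨t, Algebra.self_mem_adjoin_singleton S t⟩ : A))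
  obtain ⟨g, hg, hgn, hgb⟩ := hN b hbi
  exact exists_notMem_smul_eq_of_pow_eq P t b N.succ hb g hg (Nat.lt_succ_of_le hgn.le) hgb

/-- A Noetherian ring of dimension at least two has a prime of height two. -/
theorem exists_isPrime_height_eq_two {R : Type*} [CommRing R] [IsNoetherianRing R]
    (hdim : 2 ≤ ringKrullDim R) : ∃ p : Ideal R, p.IsPrime ∧ p.height = 2 := by
  obtain ⟨l, hl⟩ := (Order.le_krullDim_iff (α := PrimeSpectrum R) (n := 2)).mp hdim
  have h2 : (2 : ℕ∞) ≤ Order.height l.last := by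
    simpa [hl] using Order.length_le_height_last (p := l)
  rcases h2.eq_or_lt with h | h
  · exact ⟨l.last.asIdeal, l.last.2, by rw [PrimeSpectrum.height_eq_orderHeight, h]⟩
  · have hfin : Order.height l.last < ⊤ := by
      rw [← PrimeSpectrum.height_eq_orderHeight]
      exact Ideal.height_lt_top_of_isPrime
    obtain ⟨q, -, hq⟩ := (Order.coe_lt_height_iff (n := 2) hfin).mp h
    exact ⟨q.asIdeal, q.2, by rw [PrimeSpectrum.height_eq_orderHeight, hq]; rfl⟩

/-- Let `S` be an integral extension of a Noetherian ring `R`, and `P₀ < P₁ < P` primes of `S` such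
that the contraction of `P` is minimal over `(x, y)`. Then `y` does not divide `x` in `S_P`. -/
theorem mul_ne_mul_of_mem_minimalPrimes {R S : Type*} [CommRing R] [IsNoetherianRing R]
    [CommRing S] [Algebra R S] [Algebra.IsIntegral R S] {P₀ P₁ P : Ideal S} [P₀.IsPrime]
    [P₁.IsPrime] [P.IsPrime] (h₀ : P₀ < P₁) (h₁ : P₁ < P) {x y : R}
    (hP : P.under R ∈ (Ideal.span {x, y}).minimalPrimes) {a c : S} (ha : a ∉ P) :
    a * algebraMap R S x ≠ c * algebraMap R S y := by
  intro hac
  let T := Algebra.adjoin R {a, c}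
  have : Algebra.IsIntegral R T := Algebra.IsIntegral.of_injective T.val Subtype.val_injective
  have : Module.Finite R T := Module.Finite.iff_fg.mpr
    (fg_adjoin_of_finite (by simp) fun z _ => Algebra.IsIntegral.isIntegral z)
  have : IsNoetherianRing T := IsNoetherianRing.of_finite R T
  have : Algebra.IsIntegral T S := Algebra.IsIntegral.tower_top R
  let a' : T := ⟨a, Algebra.subset_adjoin (by simp)⟩
  let c' : T := ⟨c, Algebra.subset_adjoin (by simp)⟩
  have hac' : a' * algebraMap R T x = c' * algebraMap R T y := Subtype.ext hac
  have hx : algebraMap R S x ∈ P := hP.1.2 (Ideal.subset_span (by simp))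
  have hy : algebraMap R S y ∈ P := hP.1.2 (Ideal.subset_span (by simp))
  have hmin : P.under T ∈ (Ideal.span {algebraMap R T y}).minimalPrimes := by
    refine ⟨⟨inferInstance, ?_⟩, ?_⟩
    · rw [Ideal.span_singleton_le_iff_mem]
      exact hy
    · rintro Q ⟨hQ, hyQ⟩ hQP
      rw [Ideal.span_singleton_le_iff_mem] at hyQ
      have hxQ : algebraMap R T x ∈ Q := by
        refine (hQ.mem_or_mem (hac' ▸ Q.mul_mem_left c' hyQ)).resolve_left fun h => ha (hQP h)
      by_contra hne
      have hlt : Q.under R < (P.under T).under R :=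
        Ideal.IsIntegral.comap_lt_comap (lt_of_le_not_ge hQP hne)
      refine hlt.not_ge (hP.2 ⟨inferInstance, ?_⟩ hlt.le)
      rw [Ideal.span_le]
      rintro z (rfl | rfl)
      · exact hxQ
      · exact hyQ
  have hle := Ideal.height_le_one_of_isPrincipal_of_mem_minimalPrimes _ _ hmin
  have l₀ : P₀.under T < P₁.under T := Ideal.IsIntegral.comap_lt_comap h₀
  have l₁ : P₁.under T < P.under T := Ideal.IsIntegral.comap_lt_comap h₁
  have e₀ := Ideal.height_add_one_le_of_lt_of_isPrime l₀
  have e₁ := Ideal.height_add_one_le_of_lt_of_isPrime l₁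
  have h2 : (1 + 1 : ℕ∞) ≤ 1 :=
    (add_le_add_left (le_add_self.trans e₀) 1).trans (e₁.trans hle)
  exact absurd h2 (by decide)

/-- An integral extension domain of a Noetherian domain of dimension at least two has a localization
at a prime that is not a valuation ring. -/
theorem exists_isPrime_forall_mul_ne_mul {R S : Type*} [CommRing R] [IsDomain R]
    [IsNoetherianRing R] [CommRing S] [IsDomain S] [Algebra R S] [FaithfulSMul R S]
    [Algebra.IsIntegral R S] (hdim : 2 ≤ ringKrullDim R) :
    ∃ P : Ideal S, P.IsPrime ∧ ∃ x y : S, ∀ a ∉ P, ∀ c, a * x ≠ c * y ∧ a * y ≠ c * x := by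
  obtain ⟨p, hp, hp2⟩ := exists_isPrime_height_eq_two hdim
  classical
  obtain ⟨s, hs, hcard⟩ := p.exists_finset_card_eq_height_of_isNoetherianRing
  rw [hp2] at hcard
  obtain ⟨x, y, -, rfl⟩ : ∃ x y, x ≠ y ∧ s = {x, y} := Finset.card_eq_two.mp (by exact_mod_cast hcard : s.card = 2)
  rw [Finset.coe_pair] at hs
  have hlt : (1 : ℕ) < Order.height (⟨p, hp⟩ : PrimeSpectrum R) := by
    rw [← PrimeSpectrum.height_eq_orderHeight, hp2]
    decide
  obtain ⟨q, hqp, hq1⟩ := (Order.coe_lt_height_iff (by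
    rw [← PrimeSpectrum.height_eq_orderHeight, hp2]
    exact ENat.natCast_lt_top 2)).mp hlt
  rw [← PrimeSpectrum.height_eq_orderHeight] at hq1
  have hker : RingHom.ker (algebraMap R S) = ⊥ :=
    (RingHom.injective_iff_ker_eq_bot _).mp (FaithfulSMul.algebraMap_injective R S)
  obtain ⟨P₁, hP₁, hP₁q⟩ := Ideal.exists_ideal_over_prime_of_isIntegral_of_isDomain (S := S)
    q.asIdeal (hker ▸ bot_le)
  have hqp' : q.asIdeal < p := hqp
  obtain ⟨P, hle, hP, hPp⟩ := Ideal.exists_ideal_over_prime_of_isIntegral_of_isPrime p P₁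
    (hP₁q ▸ hqp'.le)
  have h₁ : P₁ < P := by
    refine lt_of_le_of_ne hle ?_
    rintro rfl
    exact hqp'.ne (hP₁q.symm.trans hPp)
  have h₀ : ⊥ < P₁ := by
    refine bot_lt_iff_ne_bot.mpr ?_
    rintro rfl
    refine Ideal.ne_bot_of_height_eq_one hq1 ?_
    rw [← hP₁q, ← RingHom.ker_eq_comap_bot, hker]
  have hPp' : P.under R = p := hPp
  refine ⟨P, hP, algebraMap R S x, algebraMap R S y, fun a ha c => ⟨?_, ?_⟩⟩
  · exact mul_ne_mul_of_mem_minimalPrimes h₀ h₁ (hPp' ▸ hs) ha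
  · exact mul_ne_mul_of_mem_minimalPrimes h₀ h₁ (hPp' ▸ Set.pair_comm x y ▸ hs) ha

/-- The absolute integral closure of a locally Nagata Noetherian integral domain
containing `ℚ` and of Krull dimension at least 2 is not universally Japanese. -/
theorem absoluteIntegralClosure_not_universallyJapanese_of_ratAlgebra
    (R : Type u) [CommRing R] [IsDomain R] [IsNoetherianRing R] [Algebra ℚ R]
    (hdim : 2 ≤ ringKrullDim R)
    (hnagata : ∀ (𝔭 : Ideal R) [𝔭.IsPrime],
      IsNagataRing (Localization.AtPrime 𝔭)) :
    ¬ UniversallyJapanese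
        (integralClosure R (AlgebraicClosure (FractionRing R))) := by
  intro hS
  let L := AlgebraicClosure (FractionRing R)
  have : Algebra.IsAlgebraic R L := 
    (IsFractionRing.comap_isAlgebraic_iff (K := FractionRing R)).mpr inferInstance
  have inj : Function.Injective (algebraMap R L) := by
    rw [IsScalarTower.algebraMap_eq R (FractionRing R) L]
    exact (algebraMap (FractionRing R) L).injective.comp (IsFractionRing.injective R _)
  have : IsFractionRing (integralClosure R L) L :=
    integralClosure.isFractionRing_of_algebraic fun x hx => inj (hx.trans (map_zero _).symm)
  have : FaithfulSMul R (integralClosure R L) :=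
    (faithfulSMul_iff_algebraMap_injective _ _).mpr fun x y h => inj (congrArg Subtype.val h)
  obtain ⟨P, hP, x, y, hxy⟩ :=
    exists_isPrime_forall_mul_ne_mul (S := integralClosure R L) hdim
  have hone : (1 : integralClosure R L) ∉ P := (Ideal.ne_top_iff_one P).mp hP.ne_top
  have hy : (y : L) ≠ 0 := fun h => (hxy 1 hone 0).2 (Subtype.ext (by simpa using h))
  obtain ⟨a, ha, c, h | h⟩ := hS.exists_notMem_smul_eq P ((x : L) / y)
  · refine (hxy a ha c).1 (Subtype.ext ?_)
    change (a : L) * (x / y) = c at h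
    change (a : L) * x = c * y
    rw [← h]
    field_simp
  · refine (hxy a ha c).2 (Subtype.ext ?_)
    change (a : L) = c * (x / y) at h
    change (a : L) * y = c * x
    rw [h]
    field_simp
end

section
/- Let R be a Noetherian integral domain of characteristic zero (so that ℤ embeds into R), of Krull dimension at least 3, and locally Nagata (the localization of R at every prime ideal is a Nagata ring). Let R⁺ be the integral closure of R in an algebraic closure of its fraction field. Then R⁺ is not universally Japanese. -/
set_option synthInstance.maxHeartbeats 400000
set_option maxHeartbeats 800000

universe u

open Polynomial

/-- A prime of height at least two contains two elements with no common prime of height at most one. -/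
theorem exists_pair_forall_not_height_le_one {R : Type*} [CommRing R] [IsDomain R] [IsNoetherianRing R]
    (p : Ideal R) [p.IsPrime] (hp : ¬ p.height ≤ 1) :
    ∃ a ∈ p, ∃ b ∈ p, ∀ q : Ideal R, q.IsPrime → a ∈ q → b ∈ q → ¬ q.height ≤ 1 := by
  obtain ⟨a, hap, ha⟩ : ∃ a ∈ p, a ≠ 0 := by
    refine Submodule.exists_mem_ne_zero_of_ne_bot fun h ↦ hp ?_
    simp [h]
  have hfin := (Ideal.span {a}).finite_minimalPrimes_of_isNoetherianRing
  obtain ⟨b, hbp, hb⟩ : ∃ b ∈ p, ∀ q ∈ (Ideal.span {a}).minimalPrimes, b ∉ q := by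
    by_contra! h
    have hsub : (p : Set R) ⊆ ⋃ q ∈ hfin.toFinset, (q : Set R) := by
      intro b hb
      obtain ⟨q, hq, hbq⟩ := h b hb
      simp only [Set.mem_iUnion]
      exact ⟨q, by simpa using hq, hbq⟩
    obtain ⟨q, hq, hpq⟩ := (Ideal.subset_union_prime (f := fun q : Ideal R ↦ q) ⊥ ⊥
      (fun q hq _ _ ↦ by
        rw [Set.Finite.mem_toFinset] at hq
        exact hq.1.1)).1 hsub
    rw [Set.Finite.mem_toFinset] at hq
    exact hp ((Ideal.height_mono hpq).trans
      (Ideal.height_le_one_of_isPrincipal_of_mem_minimalPrimes (Ideal.span {a}) q hq))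
  refine ⟨a, hap, b, hbp, fun q hq haq hbq hq1 ↦ ?_⟩
  obtain ⟨q₀, hq₀, hle⟩ := Ideal.exists_minimalPrimes_le
    ((Ideal.span_singleton_le_iff_mem q).2 haq)
  have hprime : q₀.IsPrime := hq₀.1.1
  have hlt : q₀ < q := lt_of_le_of_ne hle fun h ↦ hb q₀ hq₀ (h ▸ hbq)
  have h0 := (Ideal.height_le_iff (n := 1)).1 hq1 q₀ hprime hlt
  have : q₀.height = 0 := by simpa using h0
  rw [Ideal.height_eq_zero_iff_eq_bot] at this
  have := hq₀.1.2 (Ideal.mem_span_singleton_self a)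
  simp_all

theorem C_mem_map_C_iff {R : Type*} [CommRing R] {I : Ideal R} {r : R} :
    C r ∈ I.map (C : R →+* R[X]) ↔ r ∈ I := by
  refine ⟨fun h ↦ ?_, Ideal.mem_map_of_mem _⟩
  simpa using Ideal.mem_map_C_iff.1 h 0

/-- For a prime `p` of height at least two in a Noetherian domain `R`, some fraction `z` satisfies
only those polynomial relations over `R` whose coefficients lie in `p`. -/
theorem exists_forall_aeval_eq_zero_coeff_mem {R : Type*} [CommRing R] [IsDomain R]
    [IsNoetherianRing R] (p : Ideal R) [p.IsPrime] (hp : ¬ p.height ≤ 1) :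
    ∃ z : FractionRing R, ∀ f : R[X], aeval z f = 0 → ∀ i, f.coeff i ∈ p := by
  obtain ⟨a, ha, b, hb, hab⟩ := exists_pair_forall_not_height_le_one p hp
  let K := FractionRing R
  refine ⟨algebraMap R K a / algebraMap R K b, fun f hf ↦ ?_⟩
  have hb0 : b ≠ 0 := by
    rintro rfl
    obtain ⟨q, hq, -⟩ := Ideal.exists_minimalPrimes_le ((Ideal.span_singleton_le_iff_mem p).2 ha)
    exact hab q hq.1.1 (hq.1.2 (Ideal.mem_span_singleton_self a)) q.zero_mem
      (Ideal.height_le_one_of_isPrincipal_of_mem_minimalPrimes (Ideal.span {a}) q hq)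
  have hP : (p.map (C : R →+* R[X])).IsPrime := inferInstance
  have hg : C b * X - C a ∈ p.map (C : R →+* R[X]) :=
    sub_mem (Ideal.mul_mem_right _ _ (Ideal.mem_map_of_mem _ hb)) (Ideal.mem_map_of_mem _ ha)
  obtain ⟨N, hN, hNP⟩ := Ideal.exists_minimalPrimes_le
    ((Ideal.span_singleton_le_iff_mem _).2 hg)
  have hNprime : N.IsPrime := hN.1.1
  have hgN : C b * X - C a ∈ N := hN.1.2 (Ideal.mem_span_singleton_self _)
  have hN1 := Ideal.height_le_one_of_isPrincipal_of_mem_minimalPrimes _ N hN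
  have hcomap : N.comap (C : R →+* R[X]) = ⊥ := by
    by_contra hne
    set q := N.comap (C : R →+* R[X]) with hq
    have hqle : q.map (C : R →+* R[X]) ≤ N := Ideal.map_comap_le
    have hqprime : q.IsPrime := Ideal.comap_isPrime _ N
    have hqP : (q.map (C : R →+* R[X])).IsPrime := inferInstance
    have hq0 : q.map (C : R →+* R[X]) ≠ ⊥ := by
      rwa [Ne, Ideal.map_eq_bot_iff_of_injective C_injective]
    have hqN : q.map (C : R →+* R[X]) = N := by
      by_contra h
      have := (Ideal.height_le_iff (n := 1)).1 hN1 _ hqP (lt_of_le_of_ne hqle h)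
      exact hq0 (Ideal.height_eq_zero_iff_eq_bot.1 (by simpa using this))
    rw [← hqN, Ideal.mem_map_C_iff] at hgN
    have hbq : b ∈ q := by simpa [coeff_C] using hgN 1
    have haq : a ∈ q := by simpa [coeff_C] using hgN 0
    refine hab q hqprime haq hbq ?_
    refine (Ideal.height_le_iff (n := 1)).2 fun q' hq' hlt ↦ ?_
    have hq'P : (q'.map (C : R →+* R[X])).IsPrime := inferInstance
    have hlt' : q'.map (C : R →+* R[X]) < N := by
      rw [← hqN]
      refine lt_of_le_of_ne (Ideal.map_mono hlt.le) fun h ↦ hlt.ne ?_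
      ext r
      rw [← C_mem_map_C_iff, h, C_mem_map_C_iff]
    have := (Ideal.height_le_iff (n := 1)).1 hN1 _ hq'P hlt'
    have h0 : q'.map (C : R →+* R[X]) = ⊥ :=
      Ideal.height_eq_zero_iff_eq_bot.1 (by simpa using this)
    rw [Ideal.map_eq_bot_iff_of_injective C_injective] at h0
    simp [h0]
  let G := FractionRing (R[X] ⧸ N)
  let φ : R[X] →+* G := (algebraMap (R[X] ⧸ N) G).comp (Ideal.Quotient.mk N)
  have hφ : ∀ g, φ g = 0 → g ∈ N := fun g hg ↦ by
    rw [← Ideal.Quotient.eq_zero_iff_mem]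
    exact FaithfulSMul.algebraMap_injective (R[X] ⧸ N) G (by simpa [φ] using hg)
  have hφ' : ∀ g ∈ N, φ g = 0 := fun g hg ↦ by
    simp [φ, Ideal.Quotient.eq_zero_iff_mem.2 hg]
  have hinj : Function.Injective (φ.comp C) := by
    rw [injective_iff_map_eq_zero]
    intro r hr
    have : r ∈ N.comap (C : R →+* R[X]) := hφ _ hr
    simpa [hcomap] using this
  let ψ : K →+* G := IsFractionRing.lift hinj
  have hψ : ∀ r, ψ (algebraMap R K r) = φ (C r) := fun r ↦ IsFractionRing.lift_algebraMap hinj r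
  have hX : ψ (algebraMap R K a / algebraMap R K b) = φ X := by
    have hb' : φ (C b) ≠ 0 := by
      simpa using (map_ne_zero_iff _ hinj).2 hb0
    rw [map_div₀, hψ, hψ, div_eq_iff hb', mul_comm, ← sub_eq_zero, ← neg_eq_zero, neg_sub,
      ← map_mul, ← map_sub]
    exact hφ' _ hgN
  have hfN : f ∈ N := by
    refine hφ f ?_
    have h := congrArg ψ hf
    rw [aeval_def, hom_eval₂, map_zero, hX] at h
    rw [← h]
    conv_lhs => rw [← eval₂_C_X (p := f)]
    rw [hom_eval₂]
    congr 1
    ext r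
    exact (hψ r).symm
  exact Ideal.mem_map_C_iff.1 (hNP hfN)

theorem eq_zero_of_sum_aeval_pow_mul_pow_eq_zero {k E : Type*} [CommRing k] [CommRing E] [Algebra k E]
    {y : E} (hy : Transcendental k y) {n : ℕ} (hn : 0 < n) (g : Fin n → k[X])
    (h : ∑ i, aeval (y ^ n) (g i) * y ^ (i : ℕ) = 0) (i : Fin n) : g i = 0 := by
  have key : ∑ i, expand k n (g i) * X ^ (i : ℕ) = 0 := by
    refine transcendental_iff.1 hy _ ?_
    simpa [expand_aeval] using h
  ext j
  have hc := congrArg (fun f : k[X] ↦ f.coeff (j * n + i)) key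
  simp only [finsetSum_coeff, coeff_zero] at hc
  rw [Finset.sum_eq_single i] at hc
  · simpa [coeff_mul_X_pow, coeff_expand_mul hn] using hc
  · intro l _ hl
    rw [coeff_mul_X_pow']
    split_ifs with hle
    · rw [coeff_expand hn, if_neg]
      intro hdvd
      refine hl (Fin.ext ?_)
      have h1 : (l : ℕ) ≡ j * n + i [MOD n] := (Nat.modEq_iff_dvd' hle).2 hdvd
      have h2 : j * n + i ≡ i [MOD n] := by simp [Nat.ModEq]
      exact (h1.trans h2).eq_of_lt_of_lt l.2 i.2
    · rfl
  · simp

/-- If `D` contains roots of all orders of an element `x` generating `A` over `S` whose residue at a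
prime `Q` of `D` is transcendental, then `D` is not finite over `A`. -/
theorem not_finite_of_forall_exists_pow_eq {R S A D : Type*} [CommRing R] [CommRing S] [CommRing A]
    [CommRing D] [Algebra R S] [Algebra R D] [Algebra S A] [Algebra S D] [Algebra A D]
    [IsScalarTower R S D] [IsScalarTower S A D] [Algebra.IsIntegral R S] {x : A}
    (hx : ∀ s : A, ∃ f : S[X], aeval x f = s) (Q : Ideal D) [Q.IsPrime]
    (hQ : ∀ f : R[X], aeval (algebraMap A D x) f ∈ Q → ∀ i, algebraMap R D (f.coeff i) ∈ Q)
    (hroot : ∀ n, 0 < n → ∃ y : D, y ^ n = algebraMap A D x) : ¬ Module.Finite A D := by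
  intro hfin
  have : (Q.under S).LiesOver (Q.under R) := ⟨by rw [Ideal.under_under]⟩
  let t : D ⧸ Q := Ideal.Quotient.mk Q (algebraMap A D x)
  have ht : Transcendental (R ⧸ Q.under R) t := by
    rw [transcendental_iff]
    intro f hf
    obtain ⟨f, rfl⟩ := map_surjective _ Ideal.Quotient.mk_surjective f
    ext i
    rw [coeff_map, coeff_zero, Ideal.Quotient.eq_zero_iff_mem]
    refine hQ f ?_ i
    rw [← Ideal.Quotient.eq_zero_iff_mem, ← hf, aeval_def, aeval_def, eval₂_map, hom_eval₂]
    rfl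
  have : IsScalarTower (R ⧸ Q.under R) (S ⧸ Q.under S) (D ⧸ Q) := .of_algebraMap_eq' <| by
    ext r
    exact congrArg (Ideal.Quotient.mk Q) (IsScalarTower.algebraMap_apply R S D r)
  have ht' : Transcendental (S ⧸ Q.under S) t := ht.extendScalars_of_isIntegral _
  obtain ⟨w, hw⟩ := hfin
  obtain ⟨y, hy⟩ := hroot (w.card + 1) (by simp)
  let u : D ⧸ Q := Ideal.Quotient.mk Q y
  have hut : u ^ (w.card + 1) = t := by rw [← map_pow, hy]
  have hu : Transcendental (S ⧸ Q.under S) u := fun h ↦ ht' (hut ▸ h.pow _)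
  let _ : Algebra (S ⧸ Q.under S)[X] (D ⧸ Q) := (aeval t).toAlgebra
  classical
  have hspan : ∀ d : D, Ideal.Quotient.mk Q d ∈ Submodule.span (S ⧸ Q.under S)[X]
      ((w.image (Ideal.Quotient.mk Q) : Finset (D ⧸ Q)) : Set (D ⧸ Q)) := by
    intro d
    have hd : d ∈ Submodule.span A (w : Set D) := hw ▸ Submodule.mem_top
    induction hd using Submodule.span_induction with
    | mem d hd => exact Submodule.subset_span (by simpa using ⟨d, hd, rfl⟩)
    | zero => simp
    | add d e _ _ hd he => rw [map_add]; exact add_mem hd he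
    | smul s d _ hd =>
      obtain ⟨f, rfl⟩ := hx s
      have : Ideal.Quotient.mk Q (aeval x f • d) =
          f.map (Ideal.Quotient.mk (Q.under S)) • Ideal.Quotient.mk Q d := by
        rw [Algebra.smul_def, Algebra.smul_def, map_mul, ← aeval_algebraMap_apply]
        congr 1
        change _ = aeval t _
        rw [aeval_def, aeval_def, eval₂_map, hom_eval₂]
        rfl
      rw [this]
      exact Submodule.smul_mem _ _ hd
  have hli : LinearIndependent (S ⧸ Q.under S)[X]
      (fun i : Fin (w.card + 1) ↦ u ^ (i : ℕ)) := by
    rw [Fintype.linearIndependent_iff]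
    intro g hg
    refine eq_zero_of_sum_aeval_pow_mul_pow_eq_zero hu (by simp) g ?_
    rw [hut]
    exact hg
  have hcard := linearIndependent_le_span _ hli
    ((w.image (Ideal.Quotient.mk Q) : Finset (D ⧸ Q)) : Set (D ⧸ Q)) (by
      rw [eq_top_iff]
      rintro e -
      obtain ⟨d, rfl⟩ := Ideal.Quotient.mk_surjective e
      exact hspan d)
  have := Finset.card_image_le (s := w) (f := Ideal.Quotient.mk Q)
  simp at hcard
  omega

theorem exists_prime_forall_aeval_mem {R D : Type*} [CommRing R] [CommRing D] [IsDomain D]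
    [Algebra R D] (p : Ideal R) [p.IsPrime] (x : D)
    (hx : ∀ f : R[X], aeval x f = 0 → ∀ i, f.coeff i ∈ p)
    (hint : (aeval x : R[X] →ₐ[R] D).toRingHom.IsIntegral) :
    ∃ Q : Ideal D, Q.IsPrime ∧
      ∀ f : R[X], aeval x f ∈ Q → ∀ i, algebraMap R D (f.coeff i) ∈ Q := by
  let _ : Algebra R[X] D := (aeval x : R[X] →ₐ[R] D).toRingHom.toAlgebra
  have : Algebra.IsIntegral R[X] D := ⟨hint⟩
  obtain ⟨Q, hQ, hQp⟩ := Ideal.exists_ideal_over_prime_of_isIntegral_of_isDomain (S := D)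
    (p.map (C : R →+* R[X])) fun f hf ↦ Ideal.mem_map_C_iff.2 (hx f hf)
  refine ⟨Q, hQ, fun f hf i ↦ ?_⟩
  have hfp : f ∈ Q.comap (algebraMap R[X] D) := hf
  rw [hQp, Ideal.mem_map_C_iff] at hfp
  have hC : C (f.coeff i) ∈ Q.comap (algebraMap R[X] D) :=
    hQp ▸ Ideal.mem_map_of_mem _ (hfp i)
  have h : aeval x (C (f.coeff i)) ∈ Q := hC
  rwa [aeval_C] at h

theorem isIntegral_aeval_of_forall_exists_aeval_eq {R S A : Type*} [CommRing R] [CommRing S]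
    [CommRing A] [Algebra R S] [Algebra R A] [Algebra S A] [IsScalarTower R S A]
    [Algebra.IsIntegral R S] {x : A} (hx : ∀ s : A, ∃ f : S[X], aeval x f = s) :
    (aeval x : R[X] →ₐ[R] A).toRingHom.IsIntegral := by
  intro a
  obtain ⟨f, rfl⟩ := hx a
  have hX : (aeval x : R[X] →ₐ[R] A).toRingHom.IsIntegralElem x := by
    simpa using (aeval x : R[X] →ₐ[R] A).toRingHom.isIntegralElem_map (x := X)
  have hC : ∀ s : S, (aeval x : R[X] →ₐ[R] A).toRingHom.IsIntegralElem (algebraMap S A s) := by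
    intro s
    obtain ⟨g, hg, hgs⟩ := Algebra.IsIntegral.isIntegral (R := R) s
    refine ⟨g.map C, hg.map _, ?_⟩
    rw [eval₂_map]
    have h := congrArg (algebraMap S A) hgs
    rw [hom_eval₂, map_zero, ← IsScalarTower.algebraMap_eq] at h
    rw [← h]
    congr 1
    ext r
    simp
  induction f using Polynomial.induction_on with
  | C s => simpa using hC s
  | add f g hf hg => rw [map_add]; exact hf.add _ hg
  | monomial n s h =>
    rw [pow_succ, ← mul_assoc, map_mul, aeval_X]
    exact h.mul _ hX

theorem not_finite_integralClosure_of_forall_exists_aeval_eq {R S A Ω : Type*} [CommRing R]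
    [CommRing S] [CommRing A] [Field Ω] [IsAlgClosed Ω] [Algebra R S] [Algebra R A] [Algebra S A]
    [Algebra R Ω] [Algebra S Ω] [Algebra A Ω] [IsScalarTower R S A] [IsScalarTower R A Ω]
    [IsScalarTower S A Ω] [IsScalarTower R S Ω] [Algebra.IsIntegral R S]
    (p : Ideal R) [p.IsPrime] (x : A)
    (hx : ∀ s : A, ∃ f : S[X], aeval x f = s)
    (hxp : ∀ f : R[X], aeval (algebraMap A Ω x) f = 0 → ∀ i, f.coeff i ∈ p) :
    ¬ Module.Finite A (integralClosure A Ω) := by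
  have hint : (aeval (algebraMap A (integralClosure A Ω) x) :
      R[X] →ₐ[R] integralClosure A Ω).toRingHom.IsIntegral := by
    have h := (isIntegral_aeval_of_forall_exists_aeval_eq (R := R) hx).trans _
      (algebraMap A (integralClosure A Ω)) fun d ↦
        Algebra.IsIntegral.isIntegral (R := A) d
    have heq : (aeval (algebraMap A (integralClosure A Ω) x) :
        R[X] →ₐ[R] integralClosure A Ω).toRingHom =
          (algebraMap A (integralClosure A Ω)).comp (aeval x : R[X] →ₐ[R] A).toRingHom :=
      RingHom.ext fun f ↦ aeval_algebraMap_apply _ x f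
    rwa [heq]
  obtain ⟨Q, hQ, hQx⟩ := exists_prime_forall_aeval_mem p (algebraMap A (integralClosure A Ω) x)
    (fun f hf ↦ hxp f <| by
      have h := aeval_algebraMap_apply Ω (algebraMap A (integralClosure A Ω) x) f
      rw [hf, map_zero, ← IsScalarTower.algebraMap_apply] at h
      exact h) hint
  refine not_finite_of_forall_exists_pow_eq (R := R) (S := S) hx Q hQx fun n hn ↦ ?_
  obtain ⟨y, hy⟩ := IsAlgClosed.exists_pow_nat_eq (algebraMap A Ω x) hn
  exact ⟨⟨y, IsIntegral.of_pow hn (hy ▸ isIntegral_algebraMap)⟩, Subtype.ext hy⟩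

theorem not_universallyJapanese_integralClosure {R Ω : Type u} [CommRing R] [IsDomain R] [Field Ω]
    [IsAlgClosed Ω] [Algebra R Ω] [FaithfulSMul R Ω] [Algebra.IsAlgebraic R Ω]
    (p : Ideal R) [p.IsPrime] (w : Ω)
    (hw : ∀ f : R[X], aeval w f = 0 → ∀ i, f.coeff i ∈ p) :
    ¬ UniversallyJapanese (integralClosure R Ω) := by
  intro hUJ
  let S := integralClosure R Ω
  let A := Algebra.adjoin S {w}
  let x : A := ⟨w, Algebra.self_mem_adjoin_singleton S w⟩
  have hS : IsFractionRing S Ω := integralClosure.isFractionRing_of_algebraic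
    fun r hr ↦ FaithfulSMul.algebraMap_injective R Ω (by simpa using hr)
  have hA : IsFractionRing A Ω := IsFractionRing.of_field A Ω fun z ↦ by
    obtain ⟨a, b, -, hab⟩ := IsFractionRing.div_surjective (A := S) z
    exact ⟨algebraMap S A a, algebraMap S A b, by
      rw [← hab, ← IsScalarTower.algebraMap_apply, ← IsScalarTower.algebraMap_apply]⟩
  have : Module.Finite A (integralClosure A (FractionRing A)) :=
    hUJ A ((Subalgebra.fg_iff_finiteType A).1 ⟨{w}, by simp [A, S]⟩)
  refine not_finite_integralClosure_of_forall_exists_aeval_eq (S := S) (Ω := Ω) p x ?_ hw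
    (Module.Finite.equiv (FractionRing.algEquiv A Ω).mapIntegralClosure.toLinearEquiv)
  rintro ⟨s, hs⟩
  rw [show A = _ from Algebra.adjoin_singleton_eq_range_aeval S w] at hs
  obtain ⟨f, rfl⟩ := hs
  exact ⟨f, Subtype.ext (aeval_algebraMap_apply Ω x f).symm⟩

/-- The absolute integral closure of a locally Nagata Noetherian integral domain
of characteristic zero (so `ℤ` embeds in it) and of Krull dimension at least 3
is not universally Japanese. -/
theorem absoluteIntegralClosure_not_universallyJapanese_of_charZero
    (R : Type u) [CommRing R] [IsDomain R] [IsNoetherianRing R] [CharZero R]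
    (hdim : 3 ≤ ringKrullDim R)
    (hnagata : ∀ (𝔭 : Ideal R) [𝔭.IsPrime],
      IsNagataRing (Localization.AtPrime 𝔭)) :
    ¬ UniversallyJapanese
        (integralClosure R (AlgebraicClosure (FractionRing R))) := by
  obtain ⟨p, hp, hp1⟩ : ∃ p : Ideal R, p.IsPrime ∧ ¬ p.height ≤ 1 := by
    by_contra! h
    have h1 : ringKrullDim R ≤ 1 :=
      (ringKrullDim_le_iff_height_le 1).2 fun p hp ↦ by exact_mod_cast h p hp
    exact absurd (hdim.trans h1) (by decide)
  obtain ⟨z, hz⟩ := exists_forall_aeval_eq_zero_coeff_mem p hp1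
  have : Algebra.IsAlgebraic R (AlgebraicClosure (FractionRing R)) :=
    (IsFractionRing.comap_isAlgebraic_iff (K := FractionRing R)).2 inferInstance
  have : FaithfulSMul R (AlgebraicClosure (FractionRing R)) :=
    .trans R (FractionRing R) _
  refine not_universallyJapanese_integralClosure p
    (algebraMap (FractionRing R) (AlgebraicClosure (FractionRing R)) z) fun f hf ↦ hz f ?_
  rwa [aeval_algebraMap_apply, map_eq_zero] at hf
end

section
/- Let A be a commutative ring, M an A-module, and a, b ∈ A. Suppose that multiplication by a is injective on M and multiplication by b is injective on M/aM. Then for every A-module N, multiplication by a is injective on Hom_A(N, M), and multiplication by b is injective on Hom_A(N, M)/a·Hom_A(N, M). -/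
set_option synthInstance.maxHeartbeats 400000
set_option maxHeartbeats 800000

universe u v w

theorem Submodule.mem_ideal_span_singleton_smul_top_iff {A : Type u} [CommRing A] {X : Type v}
    [AddCommGroup X] [Module A X] {a : A} {x : X} :
    x ∈ (Ideal.span {a} • ⊤ : Submodule A X) ↔ ∃ y : X, a • y = x := by
  simp [Submodule.ideal_span_singleton_smul, Submodule.mem_smul_pointwise_iff_exists]

theorem Submodule.Quotient.smul_injective_iff {A : Type u} [CommRing A] {X : Type v}
    [AddCommGroup X] [Module A X] {S : Submodule A X} {b : A} :
    Function.Injective (fun x : X ⧸ S => b • x) ↔ ∀ x : X, b • x ∈ S → x ∈ S := by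
  change Function.Injective (LinearMap.lsmul A (X ⧸ S) b) ↔ _
  rw [injective_iff_map_eq_zero, S.mkQ_surjective.forall]
  simp [← Submodule.Quotient.mk_smul, Submodule.Quotient.mk_eq_zero]

theorem LinearMap.exists_smul_eq_of_forall {A : Type u} [CommRing A] {M : Type v}
    [AddCommGroup M] [Module A M] {N : Type w} [AddCommGroup N] [Module A N] {a : A}
    (ha : Function.Injective fun m : M => a • m) (f : N →ₗ[A] M)
    (hf : ∀ n, ∃ m, a • m = f n) : ∃ g : N →ₗ[A] M, a • g = f := by
  choose g hg using hf
  exact ⟨{ toFun := g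
           map_add' := fun x y => ha (by simp [hg])
           map_smul' := fun c x => ha (by simp [hg, smul_comm a c]) }, LinearMap.ext hg⟩

/-- Let `A` be a commutative ring, `M` an `A`-module, and `a b : A`.  If
multiplication by `a` is injective on `M` and multiplication by `b` is injective
on `M/aM`, then for every `A`-module `N`, multiplication by `a` is injective on
`Hom_A(N, M)` and multiplication by `b` is injective on
`Hom_A(N, M)/a·Hom_A(N, M)`. -/
theorem hom_torsionFree_of_torsionFree
    (A : Type u) [CommRing A] (M : Type v) [AddCommGroup M] [Module A M]
    (a b : A)
    (ha : Function.Injective fun m : M => a • m)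
    (hb : Function.Injective fun x : M ⧸ (Ideal.span {a} • ⊤ : Submodule A M) =>
      b • x)
    (N : Type w) [AddCommGroup N] [Module A N] :
    Function.Injective (fun f : N →ₗ[A] M => a • f) ∧
    Function.Injective
      (fun x : (N →ₗ[A] M) ⧸ (Ideal.span {a} • ⊤ : Submodule A (N →ₗ[A] M)) =>
        b • x) := by
  refine ⟨fun f g h => LinearMap.ext fun n => ha (LinearMap.congr_fun h n), ?_⟩
  rw [Submodule.Quotient.smul_injective_iff] at hb ⊢
  simp only [Submodule.mem_ideal_span_singleton_smul_top_iff] at hb ⊢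
  rintro f ⟨g, hg⟩
  exact f.exists_smul_eq_of_forall ha fun n => hb _ ⟨g n, LinearMap.congr_fun hg n⟩
end

section
/- Let A be an integral domain and let S, T be multiplicative subsets of A not containing 0. Assume: (i) the localization S⁻¹A is integrally closed in the fraction field of A; (ii) the localization T⁻¹A is integrally closed in the fraction field of A; (iii) for all s ∈ S and t ∈ T, multiplication by t is injective on A/sA. Then A is integrally closed in its fraction field. -/
set_option synthInstance.maxHeartbeats 400000
set_option maxHeartbeats 800000

universe u

/-- If the localization of a domain `A` at `M` is integrally closed, every element of the fraction
field of `A` integral over `A` has a denominator in `M`. -/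
theorem exists_mul_algebraMap_eq_of_isIntegral_of_localization
    {A : Type*} [CommRing A] [IsDomain A] {K : Type*} [Field K] [Algebra A K] [IsFractionRing A K]
    {M : Submonoid A} (hM0 : (0 : A) ∉ M) [IsIntegrallyClosed (Localization M)]
    {x : K} (hx : IsIntegral A x) :
    ∃ m ∈ M, ∃ a : A, x * algebraMap A K m = algebraMap A K a := by
  have hM : M ≤ nonZeroDivisors A := le_nonZeroDivisors_of_noZeroDivisors hM0
  let : Algebra (Localization M) K := IsLocalization.localizationAlgebraOfSubmonoidLe _ K M _ hM
  have : IsScalarTower A (Localization M) K :=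
    IsLocalization.localization_isScalarTower_of_submonoid_le _ K M _ hM
  have : IsFractionRing (Localization M) K :=
    IsFractionRing.isFractionRing_of_isLocalization M _ K hM
  obtain ⟨y, rfl⟩ :=
    IsIntegrallyClosed.algebraMap_eq_of_integral (R := Localization M) hx.tower_top
  obtain ⟨⟨a, m⟩, h⟩ := IsLocalization.surj M y
  refine ⟨m, m.2, a, ?_⟩
  simpa [← IsScalarTower.algebraMap_apply] using congrArg (algebraMap (Localization M) K) h

/-- An elementary version of Serre's criterion for normality: if `A` is a domain,
`S, T` are multiplicative subsets of `A` not containing `0` such that `S⁻¹A` and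
`T⁻¹A` are integrally closed (in the fraction field of `A`) and, for all `s ∈ S`
and `t ∈ T`, multiplication by `t` is injective on `A/sA`, then `A` is
integrally closed in its fraction field. -/
theorem isIntegrallyClosed_of_localizations
    (A : Type u) [CommRing A] [IsDomain A] (S T : Submonoid A)
    (hS0 : (0 : A) ∉ S) (hT0 : (0 : A) ∉ T)
    (hS : IsIntegrallyClosed (Localization S))
    (hT : IsIntegrallyClosed (Localization T))
    (hST : ∀ s ∈ S, ∀ t ∈ T,
      Function.Injective
        (fun x : A ⧸ Ideal.span {s} => Ideal.Quotient.mk (Ideal.span {s}) t * x)) :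
    IsIntegrallyClosed A := by
  refine (isIntegrallyClosed_iff (FractionRing A)).mpr fun {x} hx ↦ ?_
  obtain ⟨s, hs, a, ha⟩ := exists_mul_algebraMap_eq_of_isIntegral_of_localization hS0 hx
  obtain ⟨t, ht, b, hb⟩ := exists_mul_algebraMap_eq_of_isIntegral_of_localization hT0 hx
  have hinj : Function.Injective (algebraMap A (FractionRing A)) := IsFractionRing.injective _ _
  have hab : t * a = s * b := hinj <| by
    rw [map_mul, map_mul, ← ha, ← hb]
    ring
  have hsa : Ideal.Quotient.mk (Ideal.span {s}) a = 0 := hST s hs t ht <| by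
    simp only [mul_zero, ← map_mul, hab]
    exact Ideal.Quotient.eq_zero_iff_dvd s _ |>.mpr (dvd_mul_right s b)
  obtain ⟨c, rfl⟩ := (Ideal.Quotient.eq_zero_iff_dvd s a).mp hsa
  have hs0 : algebraMap A (FractionRing A) s ≠ 0 := fun h ↦
    hS0 ((map_eq_zero_iff _ hinj).mp h ▸ hs)
  refine ⟨c, mul_right_cancel₀ hs0 ?_⟩
  rw [ha, map_mul, mul_comm]
end
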